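/- Let N ≥ 1, let B be the open unit ball of ℝ^N, let λ₁ > 0 be the principal Dirichlet eigenvalue of −Δ on B, and let f ∈ C¹(ℝ) satisfy conditions (2) and (3). Assume additionally that the function t ↦ f(t) + λ₁ t is nondecreasing on ℝ. Then the boundary blow-up solution of Δu = f(u) in B is unique: any two boundary blow-up solutions coincide. -/

import Mathlib

open MeasureTheory Filter Metric Set Topology

/-- The Euclidean Laplacian: sum of pure second partial derivatives. -/
noncomputable def lap {N : ℕ} (u : EuclideanSpace ℝ (Fin N) → ℝ)
    (x : EuclideanSpace ℝ (Fin N)) : ℝ :=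
  ∑ i, fderiv ℝ (fun y => fderiv ℝ u y (EuclideanSpace.single i 1)) x (EuclideanSpace.single i 1)

/-- A boundary blow-up solution of `Δu = f(u)` on the open unit ball. -/
def IsBlowUp {N : ℕ} (f : ℝ → ℝ) (u : EuclideanSpace ℝ (Fin N) → ℝ) : Prop :=
  ContDiffOn ℝ 2 u (ball 0 1) ∧
  (∀ x ∈ ball (0 : EuclideanSpace ℝ (Fin N)) 1, lap u x = f (u x)) ∧
  ∀ x₀ : EuclideanSpace ℝ (Fin N), ‖x₀‖ = 1 →
    Tendsto u (𝓝[ball (0 : EuclideanSpace ℝ (Fin N)) 1] x₀) atTop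

/-- first and second derivative of a real function at a point -/
def HS (p : ℝ → ℝ) (t d1 d2 : ℝ) : Prop :=
  ∃ p' : ℝ → ℝ, (∀ᶠ s in 𝓝 t, HasDerivAt p (p' s) s) ∧ p' t = d1 ∧ HasDerivAt p' d2 t

lemma HS.add {p q : ℝ → ℝ} {t a b c d : ℝ} (hp : HS p t a b) (hq : HS q t c d) :
    HS (fun s => p s + q s) t (a + c) (b + d) := by
  obtain ⟨p', h1, h2, h3⟩ := hp
  obtain ⟨q', k1, k2, k3⟩ := hq
  refine ⟨fun s => p' s + q' s, ?_, by simp [h2, k2], h3.add k3⟩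
  filter_upwards [h1, k1] with s hs ks using hs.add ks

lemma HS.cmul {p : ℝ → ℝ} {t a b : ℝ} (k : ℝ) (hp : HS p t a b) :
    HS (fun s => k * p s) t (k * a) (k * b) := by
  obtain ⟨p', h1, h2, h3⟩ := hp
  refine ⟨fun s => k * p' s, ?_, by simp [h2], h3.const_mul k⟩
  filter_upwards [h1] with s hs using hs.const_mul k

lemma HS.sub {p q : ℝ → ℝ} {t a b c d : ℝ} (hp : HS p t a b) (hq : HS q t c d) :
    HS (fun s => p s - q s) t (a - c) (b - d) := by
  obtain ⟨p', h1, h2, h3⟩ := hp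
  obtain ⟨q', k1, k2, k3⟩ := hq
  refine ⟨fun s => p' s - q' s, ?_, by simp [h2, k2], h3.sub k3⟩
  filter_upwards [h1, k1] with s hs ks using hs.sub ks

lemma HS.poly (a b c : ℝ) : HS (fun s => a + b * s + c * s ^ 2) 0 b (2 * c) := by
  refine ⟨fun s => b + 2 * c * s, Eventually.of_forall fun s => ?_, by simp, ?_⟩
  · have := (((hasDerivAt_id s).const_mul b).const_add a).add (((hasDerivAt_id s).pow 2).const_mul c)
    exact this.congr_deriv (by simp; ring)
  · have := (((hasDerivAt_id (0:ℝ)).const_mul (2 * c)).const_add b)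
    exact this.congr_deriv (by simp)

lemma HS.congr {p q : ℝ → ℝ} {t a b : ℝ} (hp : HS p t a b) (h : ∀ s, p s = q s) : HS q t a b := by
  have : p = q := funext h
  rwa [← this]

lemma HS.max {p : ℝ → ℝ} {t a b : ℝ} (hp : HS p t a b) (h : IsLocalMax p t) : a = 0 ∧ b ≤ 0 := by
  obtain ⟨p', h1, h2, h3⟩ := hp
  have e1 : deriv p =ᶠ[𝓝 t] p' := by
    filter_upwards [h1] with s hs using hs.deriv
  have ha : a = 0 := by
    rw [← h2, ← h1.self_of_nhds.deriv]
    exact h.deriv_eq_zero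
  refine ⟨ha, ?_⟩
  by_contra hb
  push Not at hb
  have e2 : deriv (deriv p) t = b := by rw [e1.deriv_eq, h3.deriv]
  have hmin : IsLocalMin p t := by
    apply isLocalMin_of_deriv_deriv_pos
    · rw [e2]; exact hb
    · exact h.deriv_eq_zero
    · exact h1.self_of_nhds.continuousAt
  have hc : p =ᶠ[𝓝 t] fun _ => p t := by
    filter_upwards [h, hmin] with s h1 h2 using le_antisymm h1 h2
  have : deriv (deriv p) t = 0 := by
    rw [hc.deriv.deriv_eq]; simp
  linarith

lemma HS.min {p : ℝ → ℝ} {t a b : ℝ} (hp : HS p t a b) (h : IsLocalMin p t) : a = 0 ∧ 0 ≤ b := by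
  have := (hp.cmul (-1)).max (by
    filter_upwards [h] with s hs
    linarith)
  constructor <;> linarith [this.1, this.2]

section
variable {N : ℕ}

/-- the Hessian quadratic form -/
noncomputable def Hs (u : EuclideanSpace ℝ (Fin N) → ℝ) (x v : EuclideanSpace ℝ (Fin N)) : ℝ :=
  fderiv ℝ (fderiv ℝ u) x v v

lemma HS_curve {u : EuclideanSpace ℝ (Fin N) → ℝ} {c c' : ℝ → EuclideanSpace ℝ (Fin N)}
    {t : ℝ} {x v z : EuclideanSpace ℝ (Fin N)} (hc : ∀ᶠ s in 𝓝 t, HasDerivAt c (c' s) s)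
    (hx : c t = x) (hv : c' t = v) (hc' : HasDerivAt c' z t) (hu : ContDiffAt ℝ 2 u x) :
    HS (fun s => u (c s)) t (fderiv ℝ u x v) (Hs u x v + fderiv ℝ u x z) := by
  refine ⟨fun s => fderiv ℝ u (c s) (c' s), ?_, by simp [hx, hv], ?_⟩
  · have h1 : ∀ᶠ y in 𝓝 x, DifferentiableAt ℝ u y := by
      filter_upwards [hu.eventually (by simp)] with y hy
      exact hy.differentiableAt (by simp)
    have hct : ContinuousAt c t := hc.self_of_nhds.continuousAt
    rw [← hx] at h1
    filter_upwards [hc, hct.eventually h1] with s hs h2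
    exact h2.hasFDerivAt.comp_hasDerivAt s hs
  · have h2 : DifferentiableAt ℝ (fderiv ℝ u) (c t) := by
      rw [hx]
      exact (hu.fderiv_right (m := 1) (by norm_num)).differentiableAt (by simp)
    have h3 := (h2.hasFDerivAt.comp_hasDerivAt t hc.self_of_nhds).clm_apply hc'
    simpa [hx, hv, Hs] using h3

lemma HS_line {u : EuclideanSpace ℝ (Fin N) → ℝ} {x : EuclideanSpace ℝ (Fin N)}
    (hu : ContDiffAt ℝ 2 u x) (v : EuclideanSpace ℝ (Fin N)) :
    HS (fun s => u (x + s • v)) 0 (fderiv ℝ u x v) (Hs u x v) := by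
  have := HS_curve (c := fun s => x + s • v) (c' := fun _ => v) (t := 0) (x := x) (v := v) (z := 0)
    (u := u) (Eventually.of_forall fun s => by
      simpa using ((hasDerivAt_id s).smul_const v).const_add x) (by simp) rfl
      (hasDerivAt_const _ _) hu
  simpa using this

lemma lap_eq {u : EuclideanSpace ℝ (Fin N) → ℝ} {x : EuclideanSpace ℝ (Fin N)}
    (hu : ContDiffAt ℝ 2 u x) {ι : Type*} [Fintype ι]
    (b : OrthonormalBasis ι ℝ (EuclideanSpace ℝ (Fin N))) :
    lap u x = ∑ i, Hs u x (b i) := by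
  have h2 : DifferentiableAt ℝ (fderiv ℝ u) x :=
    (hu.fderiv_right (m := 1) (by norm_num)).differentiableAt (by simp)
  have e1 : lap u x = Laplacian.laplacian u x := by
    rw [InnerProductSpace.laplacian_eq_iteratedFDeriv_orthonormalBasis u
      (EuclideanSpace.basisFun (Fin N) ℝ)]
    simp only [lap, iteratedFDeriv_two_apply]
    refine Finset.sum_congr rfl fun i _ => ?_
    have : HasFDerivAt (fun y => fderiv ℝ u y (EuclideanSpace.single i 1)) _ x :=
      h2.hasFDerivAt.clm_apply (hasFDerivAt_const _ _)
    rw [this.fderiv]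
    simp
  rw [e1, InnerProductSpace.laplacian_eq_iteratedFDeriv_orthonormalBasis u b]
  simp [iteratedFDeriv_two_apply, Hs]

lemma contDiffAt_of_ball {u : EuclideanSpace ℝ (Fin N) → ℝ} (hu : ContDiffOn ℝ 2 u (ball 0 1))
    {x : EuclideanSpace ℝ (Fin N)} (hx : ‖x‖ < 1) : ContDiffAt ℝ 2 u x :=
  hu.contDiffAt (isOpen_ball.mem_nhds (by simpa using hx))

lemma continuousAt_line (x v : EuclideanSpace ℝ (Fin N)) :
    Tendsto (fun s : ℝ => x + s • v) (𝓝 0) (𝓝 x) := by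
  have : ContinuousAt (fun s : ℝ => x + s • v) 0 := by fun_prop
  simpa [ContinuousAt] using this

/-- Second order necessary condition, with a quadratic corrector. -/
lemma lap_max_test {u : EuclideanSpace ℝ (Fin N) → ℝ} {x : EuclideanSpace ℝ (Fin N)}
    (hu : ContDiffAt ℝ 2 u x) {q : EuclideanSpace ℝ (Fin N) → ℝ}
    {l : EuclideanSpace ℝ (Fin N) → ℝ} {m : EuclideanSpace ℝ (Fin N) → ℝ}
    (hq : ∀ v s, q (x + s • v) = q x + l v * s + m v * s ^ 2)
    (h : IsLocalMax (fun y => u y + q y) x) :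
    lap u x + ∑ i, 2 * m (EuclideanSpace.single i 1) ≤ 0 := by
  rw [lap_eq hu (EuclideanSpace.basisFun (Fin N) ℝ), ← Finset.sum_add_distrib]
  refine Finset.sum_nonpos fun i _ => ?_
  have h1 := (HS_line hu (EuclideanSpace.single i 1)).add
    (HS.poly (q x) (l (EuclideanSpace.single i 1)) (m (EuclideanSpace.single i 1)))
  have h2 := (h1.congr (q := fun s => u (x + s • EuclideanSpace.single i 1) +
    q (x + s • EuclideanSpace.single i 1)) (fun s => by rw [hq])).max ?_
  · simpa using h2.2
  · have := (continuousAt_line x (EuclideanSpace.single i (1:ℝ))).eventually h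
    filter_upwards [this] with s hs
    simpa using hs

lemma normsq_line (x v : EuclideanSpace ℝ (Fin N)) (s : ℝ) :
    ‖x + s • v‖ ^ 2 = ‖x‖ ^ 2 + 2 * inner ℝ x v * s + ‖v‖ ^ 2 * s ^ 2 := by
  rw [norm_add_sq_real, inner_smul_right, norm_smul, mul_pow, Real.norm_eq_abs, sq_abs]
  ring

lemma lap_comb {u w : EuclideanSpace ℝ (Fin N) → ℝ} {x : EuclideanSpace ℝ (Fin N)}
    (hu : ContDiffAt ℝ 2 u x) (hw : ContDiffAt ℝ 2 w x) (k : ℝ) :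
    lap (fun y => u y - k * w y) x = lap u x - k * lap w x := by
  have h2 : ∀ {u : EuclideanSpace ℝ (Fin N) → ℝ}, ContDiffAt ℝ 2 u x →
      DifferentiableAt ℝ (fderiv ℝ u) x := fun hu =>
    (hu.fderiv_right (m := 1) (by norm_num)).differentiableAt (by simp)
  rw [lap_eq hu (EuclideanSpace.basisFun (Fin N) ℝ), lap_eq hw (EuclideanSpace.basisFun (Fin N) ℝ),
    lap_eq (hu.sub (contDiffAt_const.mul hw)) (EuclideanSpace.basisFun (Fin N) ℝ),
    Finset.mul_sum, ← Finset.sum_sub_distrib]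
  refine Finset.sum_congr rfl fun i _ => ?_
  have e : fderiv ℝ (fun y => u y - k * w y) =ᶠ[𝓝 x] fun y => fderiv ℝ u y - k • fderiv ℝ w y := by
    filter_upwards [hu.eventually (by simp), hw.eventually (by simp)] with y h1 h2
    have d1 := h1.differentiableAt (n := 2) (by simp)
    have d2 := h2.differentiableAt (n := 2) (by simp)
    exact (d1.hasFDerivAt.sub (d2.hasFDerivAt.const_mul k)).fderiv
  have e2 := ((h2 hu).hasFDerivAt.sub ((h2 hw).hasFDerivAt.const_smul k)).fderiv
  simp only [Hs]
  rw [e.fderiv_eq]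
  erw [e2]
  simp
end

section
variable {N : ℕ}

lemma unif_blow {u : EuclideanSpace ℝ (Fin N) → ℝ}
    (h : ∀ x₀ : EuclideanSpace ℝ (Fin N), ‖x₀‖ = 1 →
    Tendsto u (𝓝[ball (0 : EuclideanSpace ℝ (Fin N)) 1] x₀) atTop) (M : ℝ) :
    ∃ r : ℝ, 0 < r ∧ r < 1 ∧ ∀ y, r < ‖y‖ → ‖y‖ < 1 → M < u y := by
  have h1 : ∀ x₀ : EuclideanSpace ℝ (Fin N), ‖x₀‖ = 1 → ∃ U : Set (EuclideanSpace ℝ (Fin N)),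
      IsOpen U ∧ x₀ ∈ U ∧ ∀ y ∈ U, ‖y‖ < 1 → M < u y := by
    intro x₀ hx
    have := (h x₀ hx).eventually (eventually_gt_atTop M)
    rw [eventually_nhdsWithin_iff, _root_.eventually_nhds_iff] at this
    obtain ⟨U, hU, hUo, hxU⟩ := this
    exact ⟨U, hUo, hxU, fun y hy hy1 => hU y hy (by simpa using hy1)⟩
  choose! U hUo hxU hU using h1
  let V : Set (EuclideanSpace ℝ (Fin N)) := ⋃ x ∈ {x : EuclideanSpace ℝ (Fin N) | ‖x‖ = 1}, U x
  have hV : IsOpen V := isOpen_biUnion fun x hx => hUo x hx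
  have hK : IsCompact (closedBall (0 : EuclideanSpace ℝ (Fin N)) 1 \ V) :=
    (isCompact_closedBall 0 1).diff hV
  have hin : ∀ y ∈ V, ‖y‖ < 1 → M < u y := by
    intro y hy h1
    simp only [V, mem_iUnion] at hy
    obtain ⟨x, hx, hy⟩ := hy
    exact hU x hx y hy h1
  rcases (closedBall (0 : EuclideanSpace ℝ (Fin N)) 1 \ V).eq_empty_or_nonempty with he | hne
  · refine ⟨1/2, by norm_num, by norm_num, fun y _ hy => hin y ?_ hy⟩
    by_contra hyV
    have : y ∈ closedBall (0 : EuclideanSpace ℝ (Fin N)) 1 \ V := ⟨by simpa using hy.le, hyV⟩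
    rw [he] at this; exact this
  · obtain ⟨z, hz, hzm⟩ := hK.exists_isMaxOn hne continuous_norm.continuousOn
    have hz1 : ‖z‖ < 1 := by
      refine lt_of_le_of_ne (by simpa using hz.1) fun he => hz.2 ?_
      simp only [V, mem_iUnion]
      exact ⟨z, he, hxU z he⟩
    refine ⟨max (1/2) ‖z‖, by positivity, max_lt (by norm_num) hz1, fun y hy hy1 => hin y ?_ hy1⟩
    by_contra hyV
    have : ‖y‖ ≤ ‖z‖ := hzm (show y ∈ closedBall (0 : EuclideanSpace ℝ (Fin N)) 1 \ V from
      ⟨by simpa using hy1.le, hyV⟩)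
    exact absurd (lt_of_le_of_lt (le_max_right _ _) hy) (not_lt.2 this)

lemma cont_closedBall {u : EuclideanSpace ℝ (Fin N) → ℝ} (hu : ContDiffOn ℝ 2 u (ball 0 1))
    {r : ℝ} (hr : r < 1) : ContinuousOn u (closedBall 0 r) :=
  hu.continuousOn.mono (closedBall_subset_ball hr)

lemma blow_bddBelow {f : ℝ → ℝ} {u : EuclideanSpace ℝ (Fin N) → ℝ} (hu : IsBlowUp f u) :
    ∃ m : ℝ, ∀ x, ‖x‖ < 1 → m ≤ u x := by
  obtain ⟨r, h0, h1, hr⟩ := unif_blow hu.2.2 0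
  obtain ⟨z, hz, hzm⟩ := (isCompact_closedBall (0 : EuclideanSpace ℝ (Fin N)) r).exists_isMinOn
    ⟨0, by simpa using h0.le⟩ (cont_closedBall hu.1 h1)
  refine ⟨min 0 (u z), fun x hx => ?_⟩
  rcases le_or_gt ‖x‖ r with h | h
  · exact (min_le_right _ _).trans (hzm (show x ∈ closedBall 0 r by simpa using h))
  · exact (min_le_left _ _).trans (hr x h hx).le

lemma blow_bddAbove {f : ℝ → ℝ} {u : EuclideanSpace ℝ (Fin N) → ℝ} (hu : IsBlowUp f u)
    {r : ℝ} (h0 : 0 ≤ r) (h1 : r < 1) :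
    ∃ m : ℝ, ∀ x, ‖x‖ ≤ r → u x ≤ m := by
  obtain ⟨z, hz, hzm⟩ := (isCompact_closedBall (0 : EuclideanSpace ℝ (Fin N)) r).exists_isMaxOn
    ⟨0, by simpa using h0⟩ (cont_closedBall hu.1 h1)
  exact ⟨u z, fun x hx => hzm (show x ∈ closedBall 0 r by simpa using hx)⟩

lemma sphere_max {f : ℝ → ℝ} {a : ℝ} (hN : 1 ≤ N) (hf0 : ∀ t > a, 0 ≤ f t)
    {u : EuclideanSpace ℝ (Fin N) → ℝ} (hu : IsBlowUp f u)
    {x0 : EuclideanSpace ℝ (Fin N)} (h1 : ‖x0‖ < 1) (ha : a < u x0)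
    (hmax : ∀ x, ‖x‖ = ‖x0‖ → u x ≤ u x0) (x : EuclideanSpace ℝ (Fin N)) (hx : ‖x‖ ≤ ‖x0‖) :
    u x ≤ u x0 := by
  by_contra hlt
  push Not at hlt
  obtain ⟨e, he, he2⟩ : ∃ e : ℝ, 0 < e ∧ e * ‖x0‖ ^ 2 < u x - u x0 := by
    refine ⟨(u x - u x0) / 2, by linarith, ?_⟩
    have : ‖x0‖ ^ 2 < 1 := by nlinarith [norm_nonneg x0]
    nlinarith
  obtain ⟨z, hz, hzm⟩ := (isCompact_closedBall (0 : EuclideanSpace ℝ (Fin N)) ‖x0‖).exists_isMaxOn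
    (f := fun y => u y + e * ‖y‖ ^ 2)
    ⟨0, by simp⟩ ((cont_closedBall hu.1 h1).add (by fun_prop))
  have hz' : ‖z‖ ≤ ‖x0‖ := by simpa using hz
  have hv : u x + e * ‖x‖ ^ 2 ≤ u z + e * ‖z‖ ^ 2 := hzm (show x ∈ closedBall 0 ‖x0‖ by simpa using hx)
  have hxe : 0 ≤ e * ‖x‖ ^ 2 := by positivity
  have hzlt : ‖z‖ < ‖x0‖ := by
    refine lt_of_le_of_ne hz' fun h => ?_
    have := hmax z h
    rw [h] at hv
    linarith
  have hzsq : e * ‖z‖ ^ 2 ≤ e * ‖x0‖ ^ 2 := by gcongr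
  have hza : a < u z := by linarith
  have hz1 : ‖z‖ < 1 := hzlt.trans h1
  have hloc : IsLocalMax (fun y => u y + e * ‖y‖ ^ 2) z := by
    refine hzm.isLocalMax ?_
    exact mem_of_superset (isOpen_ball.mem_nhds (show z ∈ ball 0 ‖x0‖ by simpa using hzlt))
      ball_subset_closedBall
  have := lap_max_test (contDiffAt_of_ball hu.1 hz1) (q := fun y => e * ‖y‖ ^ 2)
    (l := fun v => e * (2 * inner ℝ z v)) (m := fun v => e * ‖v‖ ^ 2)
    (fun v s => by rw [normsq_line]; ring) hloc
  rw [hu.2.1 z (by simpa using hz1)] at this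
  simp at this
  have h3 := hf0 _ hza
  have : (0:ℝ) < N * (2 * e) := by
    have : (1:ℝ) ≤ N := by exact_mod_cast hN
    positivity
  linarith

lemma exists_basis (hN : 1 ≤ N) {θ : EuclideanSpace ℝ (Fin N)} (hθ : ‖θ‖ = 1) :
    ∃ b : OrthonormalBasis (Fin N) ℝ (EuclideanSpace ℝ (Fin N)), b ⟨0, hN⟩ = θ := by
  have : Orthonormal ℝ (({⟨0, hN⟩} : Set (Fin N)).domRestrict (fun _ => θ)) := by
    constructor
    · intro i; simpa using hθ
    · intro i j hij
      exact absurd (Subsingleton.elim i j) hij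
  obtain ⟨b, hb⟩ := this.exists_orthonormalBasis_extension_of_card_eq (by simp)
  exact ⟨b, hb _ rfl⟩

lemma sphere_HS {u : EuclideanSpace ℝ (Fin N) → ℝ} {g : ℝ} {θ e : EuclideanSpace ℝ (Fin N)}
    (hu : ContDiffAt ℝ 2 u (g • θ)) :
    HS (fun s => u (Real.cos s • (g • θ) + Real.sin s • (g • e))) 0 (fderiv ℝ u (g • θ) (g • e))
      (g ^ 2 * Hs u (g • θ) e - g * fderiv ℝ u (g • θ) θ) := by
  have := HS_curve (c := fun s => Real.cos s • (g • θ) + Real.sin s • (g • e))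
    (c' := fun s => (- Real.sin s) • (g • θ) + Real.cos s • (g • e)) (t := 0) (x := g • θ)
    (v := g • e) (z := - (g • θ)) (u := u)
    (Eventually.of_forall fun s =>
      ((Real.hasDerivAt_cos s).smul_const _).add ((Real.hasDerivAt_sin s).smul_const _))
    (by simp) (by simp)
    (by
      have := ((Real.hasDerivAt_sin 0).neg.smul_const (g • θ)).add
        ((Real.hasDerivAt_cos 0).smul_const (g • e))
      exact this.congr_deriv (by simp)) hu
  convert this using 1
  simp [Hs]; ring

lemma norm_circle {g : ℝ} (hg : 0 < g) {θ e : EuclideanSpace ℝ (Fin N)} (hθ : ‖θ‖ = 1)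
    (he : ‖e‖ = 1) (h : inner ℝ θ e = 0) (s : ℝ) :
    ‖Real.cos s • (g • θ) + Real.sin s • (g • e)‖ = g := by
  have : ‖Real.cos s • (g • θ) + Real.sin s • (g • e)‖ ^ 2 = g ^ 2 := by
    rw [norm_add_sq_real]
    simp only [inner_smul_left, inner_smul_right, h, norm_smul, hθ, he, Real.norm_eq_abs, mul_pow,
      sq_abs]
    simp
    nlinarith [Real.sin_sq_add_cos_sq s]
  exact (sq_eq_sq₀ (norm_nonneg _) hg.le).1 this

lemma sum_split (hN : 1 ≤ N) (F : Fin N → ℝ) (c : ℝ) (h : ∀ i, i ≠ ⟨0, hN⟩ → c ≤ F i) :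
    F ⟨0, hN⟩ + (N - 1) * c ≤ ∑ i, F i := by
  have := Finset.card_nsmul_le_sum (Finset.univ.erase (⟨0, hN⟩ : Fin N)) F c
    (fun i hi => h i (Finset.ne_of_mem_erase hi))
  rw [Finset.card_erase_of_mem (Finset.mem_univ _)] at this
  simp at this
  rw [Nat.cast_sub hN] at this
  push_cast at this
  linarith

lemma lap_sphere_min (hN : 1 ≤ N) {u : EuclideanSpace ℝ (Fin N) → ℝ} {g : ℝ} (hg : 0 < g)
    {θ : EuclideanSpace ℝ (Fin N)} (hθ : ‖θ‖ = 1)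
    (hu : ContDiffAt ℝ 2 u (g • θ)) (hmin : ∀ y, ‖y‖ = g → u (g • θ) ≤ u y) :
    Hs u (g • θ) θ + (N - 1) * (fderiv ℝ u (g • θ) θ / g) ≤ lap u (g • θ) := by
  obtain ⟨b, hb⟩ := exists_basis hN hθ
  rw [lap_eq hu b]
  conv_lhs => rw [← hb]
  rw [hb]
  have := sum_split hN (fun i => Hs u (g • θ) (b i)) (fderiv ℝ u (g • θ) θ / g) ?_
  · simpa only [hb] using this
  · intro i hi
    have ho : inner ℝ θ (b i) = 0 := by
      rw [← hb]; exact b.orthonormal.2 (Ne.symm hi)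
    have h1 := (sphere_HS (e := b i) hu).min (by
      refine Eventually.of_forall fun s => ?_
      have := hmin _ (norm_circle hg hθ (b.orthonormal.1 i) ho s)
      simpa using this)
    rw [div_le_iff₀ hg]
    have := h1.2
    by_contra hc
    push Not at hc
    nlinarith

lemma lap_sphere_max (hN : 1 ≤ N) {u : EuclideanSpace ℝ (Fin N) → ℝ} {g : ℝ} (hg : 0 < g)
    {θ : EuclideanSpace ℝ (Fin N)} (hθ : ‖θ‖ = 1)
    (hu : ContDiffAt ℝ 2 u (g • θ)) (hmax : ∀ y, ‖y‖ = g → u y ≤ u (g • θ)) :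
    lap u (g • θ) ≤ Hs u (g • θ) θ + (N - 1) * (fderiv ℝ u (g • θ) θ / g) := by
  obtain ⟨b, hb⟩ := exists_basis hN hθ
  rw [lap_eq hu b]
  have := sum_split hN (fun i => - Hs u (g • θ) (b i)) (- (fderiv ℝ u (g • θ) θ / g)) ?_
  · simp only [hb, Finset.sum_neg_distrib] at this
    linarith
  · intro i hi
    have ho : inner ℝ θ (b i) = 0 := by
      rw [← hb]; exact b.orthonormal.2 (Ne.symm hi)
    have h1 := (sphere_HS (e := b i) hu).max (by
      refine Eventually.of_forall fun s => ?_
      have := hmax _ (norm_circle hg hθ (b.orthonormal.1 i) ho s)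
      simpa using this)
    rw [neg_le_neg_iff, le_div_iff₀ hg]
    have := h1.2
    by_contra hc
    push Not at hc
    nlinarith
end

lemma g_bracket {N r ρ e : ℝ} (hN : 1 ≤ N) (hρ : 1 / 2 ≤ ρ) (hr : ρ ≤ r) (hr1 : r ≤ 1)
    (h8 : 8 * N * (1 - ρ) ≤ 1) (he : 0 < e) (he1 : e ≤ 1) :
    r + e / 2 ≤ r + e * (1 - 4 * N * (r - ρ) ^ 2) ∧
    r + e * (1 - 4 * N * (r - ρ) ^ 2) ≤ r + e ∧
    0 ≤ 1 - 8 * N * e * (r - ρ) ∧ 1 - 8 * N * e * (r - ρ) ≤ 1 ∧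
    - (8 * N * e) + (N - 1) * ((1 - 8 * N * e * (r - ρ)) / r -
      (1 - 8 * N * e * (r - ρ)) ^ 2 / (r + e * (1 - 4 * N * (r - ρ) ^ 2))) ≤ 0 := by
  have hd : 0 ≤ r - ρ := by linarith
  have h1 : 8 * N * (r - ρ) ≤ 1 := by nlinarith
  have h1' : 0 ≤ N * (r - ρ) := by positivity
  have h2 : 4 * N * (r - ρ) ^ 2 ≤ 1 / 2 := by nlinarith
  have h3 : 0 ≤ N * (r - ρ) ^ 2 := by positivity
  have A : r + e / 2 ≤ r + e * (1 - 4 * N * (r - ρ) ^ 2) := by nlinarith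
  have B : r + e * (1 - 4 * N * (r - ρ) ^ 2) ≤ r + e := by nlinarith
  have C : 0 ≤ 1 - 8 * N * e * (r - ρ) := by nlinarith
  have D : 1 - 8 * N * e * (r - ρ) ≤ 1 := by nlinarith
  refine ⟨A, B, C, D, ?_⟩
  set g := r + e * (1 - 4 * N * (r - ρ) ^ 2) with hg
  set p := 1 - 8 * N * e * (r - ρ) with hp
  have hg0 : 1 / 2 ≤ g := by linarith
  have hr0 : 1 / 2 ≤ r := by linarith
  have key : p / r - p ^ 2 / g ≤ 8 * e := by
    have : p / r - p ^ 2 / g = p * (g - r * p) / (r * g) := by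
      field_simp
    rw [this, div_le_iff₀ (by positivity)]
    have e1 : g - r * p = e * (1 - 4 * N * (r - ρ) ^ 2 + 8 * N * (r - ρ) * r) := by
      rw [hg, hp]; ring
    have e2 : g - r * p ≤ 2 * e := by
      rw [e1]
      have : 8 * N * (r - ρ) * r ≤ 1 := by nlinarith
      nlinarith
    have e3 : p * (g - r * p) ≤ 2 * e := by
      calc p * (g - r * p) ≤ p * (2 * e) := by gcongr
        _ ≤ 1 * (2 * e) := by gcongr
        _ = 2 * e := by ring
    have e4 : 1 / 4 ≤ r * g := by nlinarith
    nlinarith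
  nlinarith

lemma final_alg {N f1 f2 H1 H2 U1 U2 r0 g0 gp gpp C : ℝ} (hr : 0 < r0)
    (h2 : f2 ≤ H2 + (N - 1) * (U2 / r0)) (h1 : H1 + (N - 1) * (U1 / g0) ≤ f1)
    (ha : U2 - gp * U1 + 2 * C * r0 = 0) (hb : H2 - (gp ^ 2 * H1 + gpp * U1) + 2 * C ≤ 0)
    (hU : 0 ≤ U2) (hf : 0 ≤ f1) (hC : 0 < C) (hgp : 0 ≤ gp) (hgp1 : gp ≤ 1)
    (hbr : gpp + (N - 1) * (gp / r0 - gp ^ 2 / g0) ≤ 0) : f2 + 2 * N * C ≤ f1 := by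
  have hU1 : 0 ≤ U1 := by
    by_contra h
    push Not at h
    have : 0 < C * r0 := by positivity
    nlinarith
  have e1 : U2 / r0 = gp * U1 / r0 - 2 * C := by
    have : U2 = gp * U1 - 2 * C * r0 := by linarith
    rw [this]; field_simp
  have e2 : gp ^ 2 * (H1 + (N - 1) * (U1 / g0)) ≤ gp ^ 2 * f1 := by gcongr
  have e3 : gp ^ 2 * f1 ≤ 1 * f1 := by gcongr; nlinarith
  have e4 := mul_nonneg_of_nonpos_of_nonpos hbr (neg_nonpos.2 hU1)
  rw [e1] at h2
  have e5 : gp * U1 / r0 = gp / r0 * U1 := by ring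
  have e6 : gp ^ 2 * ((N - 1) * (U1 / g0)) = (N - 1) * (gp ^ 2 / g0) * U1 := by ring
  rw [e5] at h2
  nlinarith

section
variable {N : ℕ}

lemma step1_int {f : ℝ → ℝ} {a : ℝ} (hN : 1 ≤ N) (hf0 : ∀ t > a, 0 ≤ f t) {lam : ℝ} (hlam : 0 < lam)
    (hmono : Monotone fun t => f t + lam * t)
    {u₁ u₂ : EuclideanSpace ℝ (Fin N) → ℝ} (hu₁ : IsBlowUp f u₁) (hu₂ : IsBlowUp f u₂)
    {ρ : ℝ} (hρ : 1 / 2 ≤ ρ) (h8 : 8 * (N : ℝ) * (1 - ρ) ≤ 1)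
    (hl : lam * (1 - ρ ^ 2) < 2 * N)
    (ha₁ : ∀ y, ρ ≤ ‖y‖ → ‖y‖ < 1 → a < u₁ y) (ha₂ : ∀ y, ρ ≤ ‖y‖ → ‖y‖ < 1 → a < u₂ y)
    {e : ℝ} (he : 0 < e) (he1 : e ≤ 1) {r1 r0 g0 C1 : ℝ} {x0 y0 : EuclideanSpace ℝ (Fin N)}
    (hr0 : r0 = ‖x0‖) (hg0 : g0 = ‖y0‖) (hC1p : 0 < C1)
    (hmax' : ∀ x y : EuclideanSpace ℝ (Fin N), ρ ≤ ‖x‖ → ‖x‖ ≤ 1 →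
      ‖y‖ = ‖x‖ + e * (1 - 4 * N * (‖x‖ - ρ) ^ 2) → ‖y‖ ≤ r1 → u₂ x - u₁ y ≤ C1 * (1 - ‖x‖ ^ 2))
    (heq : u₂ x0 - u₁ y0 = C1 * (1 - r0 ^ 2)) (hps0 : 0 < 1 - r0 ^ 2)
    (hx0ρ : ρ ≤ r0) (hx01 : r0 ≤ 1) (hy0 : g0 = r0 + e * (1 - 4 * N * (r0 - ρ) ^ 2))
    (hx0lt : r0 < 1) (hy0lt1 : g0 < 1) (hy0lt : g0 < r1) (hx0gt : ρ < r0) : False := by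
  have hNr : (1:ℝ) ≤ N := by exact_mod_cast hN
  obtain ⟨b1, b2, b3, b4, b5⟩ := g_bracket hNr hρ hx0ρ hx01 h8 he he1
  rw [← hy0] at b1 b2 b5
  have hr0p : 0 < r0 := by linarith
  have hg0p : 0 < g0 := by linarith
  obtain ⟨θ, hθ, hx0θ⟩ : ∃ θ : EuclideanSpace ℝ (Fin N), ‖θ‖ = 1 ∧ x0 = r0 • θ := by
    refine ⟨r0⁻¹ • x0, ?_, ?_⟩
    · rw [norm_smul, Real.norm_eq_abs, abs_of_pos (by positivity), ← hr0]; field_simp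
    · rw [smul_smul, mul_inv_cancel₀ hr0p.ne', one_smul]
  obtain ⟨η, hη, hy0η⟩ : ∃ η : EuclideanSpace ℝ (Fin N), ‖η‖ = 1 ∧ y0 = g0 • η := by
    refine ⟨g0⁻¹ • y0, ?_, ?_⟩
    · rw [norm_smul, Real.norm_eq_abs, abs_of_pos (by positivity), ← hg0]; field_simp
    · rw [smul_smul, mul_inv_cancel₀ hg0p.ne', one_smul]
  have c2 : ContDiffAt ℝ 2 u₂ x0 := contDiffAt_of_ball hu₂.1 (hr0 ▸ hx0lt)
  have c1 : ContDiffAt ℝ 2 u₁ y0 := contDiffAt_of_ball hu₁.1 (hg0 ▸ hy0lt1)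
  have hsmax : ∀ x, ‖x‖ = r0 → u₂ x ≤ u₂ x0 := by
    intro x hx
    have := hmax' x y0 (by rw [hx]; exact hx0ρ) (by rw [hx]; exact hx01) (by rw [hx, ← hg0]; exact hy0)
      (by rw [← hg0]; exact hy0lt.le)
    rw [hx] at this
    linarith
  have hsmin : ∀ y, ‖y‖ = g0 → u₁ y0 ≤ u₁ y := by
    intro y hy
    have := hmax' x0 y (by rw [← hr0]; exact hx0ρ) (by rw [← hr0]; exact hx01)
      (by rw [hy, ← hr0]; exact hy0) (by rw [hy]; exact hy0lt.le)
    rw [← hr0] at this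
    linarith
  have L2 := lap_sphere_max hN hr0p hθ (u := u₂) (by rwa [← hx0θ])
    (by intro y hy; rw [← hx0θ]; exact hsmax y hy)
  have L1 := lap_sphere_min hN hg0p hη (u := u₁) (by rwa [← hy0η])
    (by intro y hy; rw [← hy0η]; exact hsmin y hy)
  rw [← hx0θ, hu₂.2.1 x0 (by simpa [← hr0] using hx0lt)] at L2
  rw [← hy0η, hu₁.2.1 y0 (by simpa [← hg0] using hy0lt1)] at L1
  -- radial monotonicity
  have hU2 : 0 ≤ fderiv ℝ u₂ x0 θ := by
    have hm := sphere_max hN hf0 hu₂ (x0 := x0) (hr0 ▸ hx0lt) (ha₂ x0 (hr0 ▸ hx0ρ) (hr0 ▸ hx0lt))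
      (by rw [← hr0]; exact hsmax)
    rw [← hr0] at hm
    have h1 : IsLocalMaxOn u₂ (closedBall 0 r0) x0 := by
      refine IsMaxOn.localize fun x hx => hm x ?_
      simpa using hx
    have h2 := h1.hasFDerivWithinAt_nonpos
      (c2.differentiableAt (by simp)).hasFDerivAt.hasFDerivWithinAt
      (sub_mem_posTangentConeAt_of_segment_subset (y := 0)
        ((convex_closedBall (0 : EuclideanSpace ℝ (Fin N)) r0).segment_subset
          (by simp [hr0]) (by simpa using hr0p.le)))
    rw [zero_sub, map_neg] at h2
    have h3 := (fderiv ℝ u₂ x0).map_smul r0 θ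
    rw [← hx0θ, smul_eq_mul] at h3
    rw [h3] at h2
    exact nonneg_of_mul_nonneg_right (by linarith : 0 ≤ r0 * fderiv ℝ u₂ x0 θ) hr0p
  -- radial test
  have S2 := HS_line c2 θ
  have S1 := HS_curve (u := u₁)
    (c := fun s => (r0 + s + e * (1 - 4 * N * (r0 + s - ρ) ^ 2)) • η)
    (c' := fun s => (1 - 8 * N * e * (r0 + s - ρ)) • η) (t := 0) (x := y0)
    (v := (1 - 8 * N * e * (r0 - ρ)) • η) (z := (- (8 * N * e)) • η)
    (Eventually.of_forall fun s => by
      apply HasDerivAt.smul_const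
      have h0 : HasDerivAt (fun s : ℝ => r0 + s) 1 s := (hasDerivAt_id s).const_add r0
      have := h0.add ((((((h0.sub_const ρ).pow 2).const_mul (4 * (N:ℝ))).const_sub 1)).const_mul e)
      exact this.congr_deriv (by simp; ring))
    (by simp only [add_zero]; rw [← hy0]; exact hy0η.symm) (by simp)
    (by
      apply HasDerivAt.smul_const
      have h0 : HasDerivAt (fun s : ℝ => r0 + s) 1 0 := (hasDerivAt_id 0).const_add r0
      have := ((h0.sub_const ρ).const_mul (8 * (N:ℝ) * e)).const_sub 1
      exact this.congr_deriv (by simp)) c1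
  have S3 := (S2.sub S1).sub (HS.poly (C1 * (1 - r0 ^ 2)) (-(2 * C1 * r0)) (-C1))
  have T := S3.max (by
    have k1 : ∀ᶠ s : ℝ in 𝓝 0, ρ < r0 + s := by
      have : ContinuousAt (fun s : ℝ => r0 + s) 0 := by fun_prop
      exact this.eventually (lt_mem_nhds (by simpa using hx0gt))
    have k2 : ∀ᶠ s : ℝ in 𝓝 0, r0 + s < 1 := by
      have : ContinuousAt (fun s : ℝ => r0 + s) 0 := by fun_prop
      exact this.eventually (gt_mem_nhds (by simpa using hx0lt))
    have k3 : ∀ᶠ s : ℝ in 𝓝 0, r0 + s + e * (1 - 4 * N * (r0 + s - ρ) ^ 2) < r1 := by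
      have : ContinuousAt (fun s : ℝ => r0 + s + e * (1 - 4 * N * (r0 + s - ρ) ^ 2)) 0 := by fun_prop
      exact this.eventually (gt_mem_nhds (by simp only [add_zero]; rw [← hy0]; exact hy0lt))
    filter_upwards [k1, k2, k3] with s h1 h2 h3
    have hb := (g_bracket hNr hρ h1.le h2.le h8 he he1).1
    have n1 : ‖x0 + s • θ‖ = r0 + s := by
      have : x0 + s • θ = (r0 + s) • θ := by rw [add_smul, ← hx0θ]
      rw [this, norm_smul, hθ, Real.norm_eq_abs, abs_of_pos (by linarith), mul_one]
    have n2 : ‖(r0 + s + e * (1 - 4 * N * (r0 + s - ρ) ^ 2)) • η‖ =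
        r0 + s + e * (1 - 4 * N * (r0 + s - ρ) ^ 2) := by
      rw [norm_smul, hη, Real.norm_eq_abs, abs_of_pos (by linarith), mul_one]
    have := hmax' (x0 + s • θ) ((r0 + s + e * (1 - 4 * N * (r0 + s - ρ) ^ 2)) • η)
      (by rw [n1]; exact h1.le) (by rw [n1]; exact h2.le) (by rw [n1, n2])
        (by rw [n2]; exact h3.le)
    rw [n1] at this
    have hz : (r0 + 0 + e * (1 - 4 * N * (r0 + 0 - ρ) ^ 2)) • η = y0 := by
      simp only [add_zero]; rw [← hy0]; exact hy0η.symm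
    rw [hz]
    simp only [zero_smul, add_zero]
    linarith)
  have hH : Hs u₁ y0 ((1 - 8 * N * e * (r0 - ρ)) • η) =
      (1 - 8 * N * e * (r0 - ρ)) ^ 2 * Hs u₁ y0 η := by
    simp [Hs]; ring
  rw [hH, map_smul, map_smul, smul_eq_mul, smul_eq_mul] at T
  have hf1 := hf0 _ (ha₁ y0 (by linarith) (hg0 ▸ hy0lt1))
  have fin := final_alg (N := N) (C := C1) hr0p L2 L1 (by linarith [T.1]) (by linarith [T.2]) hU2
    hf1 hC1p b3 b4 b5
  have hm : f (u₁ y0) + lam * u₁ y0 ≤ f (u₂ x0) + lam * u₂ x0 := by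
    apply hmono
    have : 0 < C1 * (1 - r0 ^ 2) := by positivity
    linarith
  have h1 : 2 * N * C1 ≤ lam * (C1 * (1 - r0 ^ 2)) := by
    rw [← heq]; linarith
  have h2 : lam * (1 - r0 ^ 2) < 2 * N := by
    refine lt_of_le_of_lt ?_ hl
    gcongr
  have h3 := mul_lt_mul_of_pos_left h2 hC1p
  linarith

lemma step1_K {u₁ u₂ : EuclideanSpace ℝ (Fin N) → ℝ} (c1 : ContinuousOn u₁ (ball 0 1))
    (c2 : ContinuousOn u₂ (ball 0 1)) {ρ e r1 C : ℝ} (g : ℝ → ℝ) (hg : Continuous g)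
    (hr1 : r1 < 1) (he : 0 < e)
    (hgb : ∀ r, ρ ≤ r → r ≤ 1 → r + e / 2 ≤ g r)
    {xx yy : EuclideanSpace ℝ (Fin N)} (hxx : ρ ≤ ‖xx‖) (hxx1 : ‖xx‖ ≤ 1)
    (hyy : ‖yy‖ = g ‖xx‖) (hr1y : ‖yy‖ ≤ r1) (hcon : C * (1 - ‖xx‖ ^ 2) < u₂ xx - u₁ yy) :
    ∃ (x0 y0 : EuclideanSpace ℝ (Fin N)) (C1 : ℝ), C < C1 ∧ ρ ≤ ‖x0‖ ∧ ‖x0‖ ≤ 1 - e / 2 ∧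
      ‖y0‖ = g ‖x0‖ ∧ ‖y0‖ ≤ r1 ∧ u₂ x0 - u₁ y0 = C1 * (1 - ‖x0‖ ^ 2) ∧
      ∀ x y : EuclideanSpace ℝ (Fin N), ρ ≤ ‖x‖ → ‖x‖ ≤ 1 →
        ‖y‖ = g ‖x‖ → ‖y‖ ≤ r1 → u₂ x - u₁ y ≤ C1 * (1 - ‖x‖ ^ 2) := by
  obtain ⟨K, hKdef⟩ : ∃ K : Set (EuclideanSpace ℝ (Fin N) × EuclideanSpace ℝ (Fin N)), K =
    {p | ρ ≤ ‖p.1‖ ∧ ‖p.1‖ ≤ 1 ∧ ‖p.2‖ = g ‖p.1‖ ∧ ‖p.2‖ ≤ r1} := ⟨_, rfl⟩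
  have hKm : ∀ x y : EuclideanSpace ℝ (Fin N), (x, y) ∈ K ↔ (ρ ≤ ‖x‖ ∧ ‖x‖ ≤ 1 ∧
      ‖y‖ = g ‖x‖ ∧ ‖y‖ ≤ r1) := by
    intro x y
    rw [hKdef]
    exact Iff.rfl
  have hKb : ∀ x y, (x, y) ∈ K → ‖x‖ ≤ 1 - e / 2 := by
    intro x y hp
    obtain ⟨h1, h2, h3, h4⟩ := (hKm x y).1 hp
    have := hgb _ h1 h2
    linarith
  have hKc : IsCompact K := by
    refine ((isCompact_closedBall (0 : EuclideanSpace ℝ (Fin N)) 1).prod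
      (isCompact_closedBall (0 : EuclideanSpace ℝ (Fin N)) 1)).of_isClosed_subset ?_ ?_
    · simp only [hKdef, ofPred_and]
      refine IsClosed.inter ?_ (IsClosed.inter ?_ (IsClosed.inter ?_ ?_))
      · exact isClosed_le (by fun_prop) (by fun_prop)
      · exact isClosed_le (by fun_prop) (by fun_prop)
      · exact isClosed_eq (by fun_prop) (by fun_prop)
      · exact isClosed_le (by fun_prop) (by fun_prop)
    · rintro ⟨x, y⟩ hp
      obtain ⟨h1, h2, h3, h4⟩ := (hKm x y).1 hp
      exact ⟨by simpa using h2, by simpa using h4.trans hr1.le⟩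
  have hpsi : ∀ x y, (x, y) ∈ K → 0 < 1 - ‖x‖ ^ 2 := by
    intro x y hp
    have h1 := hKb x y hp
    have h2 := norm_nonneg x
    have h3 : ‖x‖ < 1 := by linarith
    nlinarith
  have hcont : ContinuousOn (fun p : EuclideanSpace ℝ (Fin N) × EuclideanSpace ℝ (Fin N) =>
      (u₂ p.1 - u₁ p.2) / (1 - ‖p.1‖ ^ 2)) K := by
    refine ContinuousOn.div (ContinuousOn.sub ?_ ?_) (by fun_prop) fun p hp => (hpsi p.1 p.2 hp).ne'
    · refine c2.comp continuousOn_fst fun p hp => ?_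
      have := hKb p.1 p.2 hp
      rw [mem_ball_zero_iff]; linarith
    · refine c1.comp continuousOn_snd fun p hp => ?_
      have := ((hKm p.1 p.2).1 hp).2.2.2
      rw [mem_ball_zero_iff]; linarith
  have hxyK : (xx, yy) ∈ K := (hKm _ _).2 ⟨hxx, hxx1, hyy, hr1y⟩
  obtain ⟨⟨x0, y0⟩, hp0, hmax⟩ := hKc.exists_isMaxOn ⟨_, hxyK⟩ hcont
  have hmx : ∀ x y, (x, y) ∈ K → (u₂ x - u₁ y) / (1 - ‖x‖ ^ 2) ≤
      (u₂ x0 - u₁ y0) / (1 - ‖x0‖ ^ 2) := fun x y h => hmax h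
  have hps0 := hpsi _ _ hp0
  obtain ⟨hx0ρ, hx01, hy0, hy0r⟩ := (hKm _ _).1 hp0
  refine ⟨x0, y0, (u₂ x0 - u₁ y0) / (1 - ‖x0‖ ^ 2), ?_, hx0ρ, hKb _ _ hp0, hy0, hy0r, ?_, ?_⟩
  · refine lt_of_lt_of_le ?_ (hmx _ _ hxyK)
    rw [lt_div_iff₀ (hpsi _ _ hxyK)]
    exact hcon
  · rw [div_mul_cancel₀ _ hps0.ne']
  · intro x y h1 h2 h3 h4
    have hp := (hKm x y).2 ⟨h1, h2, h3, h4⟩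
    exact (div_le_iff₀ (hpsi x y hp)).1 (hmx _ _ hp)

lemma step1 {f : ℝ → ℝ} {a : ℝ} (hN : 1 ≤ N) (hf0 : ∀ t > a, 0 ≤ f t) {lam : ℝ} (hlam : 0 < lam)
    (hmono : Monotone fun t => f t + lam * t)
    {u₁ u₂ : EuclideanSpace ℝ (Fin N) → ℝ} (hu₁ : IsBlowUp f u₁) (hu₂ : IsBlowUp f u₂)
    {ρ : ℝ} (hρ : 1 / 2 ≤ ρ) (hρ1 : ρ < 1) (h8 : 8 * (N : ℝ) * (1 - ρ) ≤ 1)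
    (hl : lam * (1 - ρ ^ 2) < 2 * N)
    (ha₁ : ∀ y, ρ ≤ ‖y‖ → ‖y‖ < 1 → a < u₁ y) (ha₂ : ∀ y, ρ ≤ ‖y‖ → ‖y‖ < 1 → a < u₂ y)
    {C : ℝ} (hC0 : 0 ≤ C) (hC : ∀ x, ‖x‖ = ρ → ∀ y, ‖y‖ < 1 → u₂ x - u₁ y ≤ C * (1 - ρ ^ 2))
    {e : ℝ} (he : 0 < e) (he1 : e ≤ 1)
    {xx yy : EuclideanSpace ℝ (Fin N)} (hxx : ρ ≤ ‖xx‖) (hxx1 : ‖xx‖ ≤ 1)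
    (hyy : ‖yy‖ = ‖xx‖ + e * (1 - 4 * N * (‖xx‖ - ρ) ^ 2)) (hyy1 : ‖yy‖ < 1) :
    u₂ xx - u₁ yy ≤ C * (1 - ‖xx‖ ^ 2) := by
  have hNr : (1:ℝ) ≤ N := by exact_mod_cast hN
  by_contra hcon
  push Not at hcon
  obtain ⟨M, hM⟩ := blow_bddAbove hu₂ (r := 1 - e / 2) (by linarith) (by linarith)
  obtain ⟨rb, hrb0, hrb1, hrb⟩ := unif_blow hu₁.2.2 M
  obtain ⟨r1, hr1, hr1b, hr1y⟩ : ∃ r1 : ℝ, r1 < 1 ∧ rb < r1 ∧ ‖yy‖ ≤ r1 := by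
    refine ⟨(1 + max rb ‖yy‖) / 2, ?_, ?_, ?_⟩
    · have := max_lt hrb1 hyy1; linarith
    · have := le_max_left rb ‖yy‖; linarith
    · have := le_max_right rb ‖yy‖; linarith
  obtain ⟨x0, y0, C1, hCC, hx0ρ, hx0b, hy0, hy0r, heq, hmax'⟩ :=
    step1_K (ρ := ρ) (C := C) hu₁.1.continuousOn hu₂.1.continuousOn
      (fun r => r + e * (1 - 4 * N * (r - ρ) ^ 2)) (by fun_prop) hr1 he
      (fun r h1 h2 => (g_bracket hNr hρ h1 h2 h8 he he1).1) hxx hxx1 hyy hr1y hcon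
  have hC1p : 0 < C1 := lt_of_le_of_lt hC0 hCC
  have hx0lt : ‖x0‖ < 1 := by linarith
  have hy0lt1 : ‖y0‖ < 1 := by linarith
  have hps0 : 0 < 1 - ‖x0‖ ^ 2 := by
    have := norm_nonneg x0
    nlinarith
  have hpos : 0 < C1 * (1 - ‖x0‖ ^ 2) := mul_pos hC1p hps0
  -- strict interior
  have hy0lt : ‖y0‖ < r1 := by
    refine lt_of_le_of_ne hy0r fun h => ?_
    have h1 := hrb y0 (by linarith) hy0lt1
    have h2 := hM x0 hx0b
    linarith
  have hx0gt : ρ < ‖x0‖ := by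
    refine lt_of_le_of_ne hx0ρ fun h => ?_
    have h1 := hC x0 h.symm y0 hy0lt1
    rw [heq, ← h] at h1
    rw [← h] at hps0
    exact absurd (le_of_mul_le_mul_right h1 hps0) (not_le.2 hCC)
  exact step1_int hN hf0 hlam hmono hu₁ hu₂ hρ h8 hl ha₁ ha₂ he he1 rfl rfl hC1p
    hmax' heq hps0 hx0ρ hx0lt.le hy0 hx0lt hy0lt1 hy0lt hx0gt
end
section
variable {N : ℕ}

lemma step1b {f : ℝ → ℝ} {a : ℝ} (hN : 1 ≤ N) (hf0 : ∀ t > a, 0 ≤ f t) {lam : ℝ} (hlam : 0 < lam)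
    (hmono : Monotone fun t => f t + lam * t)
    {u₁ u₂ : EuclideanSpace ℝ (Fin N) → ℝ} (hu₁ : IsBlowUp f u₁) (hu₂ : IsBlowUp f u₂) :
    ∃ ρ C : ℝ, ρ < 1 ∧ 0 ≤ C ∧ ∀ x, ρ ≤ ‖x‖ → ‖x‖ < 1 → u₂ x - u₁ x ≤ C * (1 - ‖x‖ ^ 2) := by
  have hNr : (1:ℝ) ≤ N := by exact_mod_cast hN
  obtain ⟨ra, _, hra, hra'⟩ := unif_blow hu₁.2.2 a
  obtain ⟨rb, _, hrb, hrb'⟩ := unif_blow hu₂.2.2 a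
  obtain ⟨ρ, h1, h2, h3, h4, h5, h6⟩ : ∃ ρ : ℝ, 1 / 2 ≤ ρ ∧ ρ < 1 ∧ 8 * (N : ℝ) * (1 - ρ) ≤ 1 ∧
      lam * (1 - ρ ^ 2) < 2 * N ∧ ra < ρ ∧ rb < ρ := by
    have k1 : ∀ᶠ ρ : ℝ in 𝓝[<] 1, 1 / 2 < ρ := nhdsWithin_le_nhds (lt_mem_nhds (by norm_num))
    have k2 : ∀ᶠ ρ : ℝ in 𝓝[<] 1, ρ < 1 := self_mem_nhdsWithin
    have k3 : ∀ᶠ ρ : ℝ in 𝓝[<] 1, 8 * (N : ℝ) * (1 - ρ) < 1 := by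
      have : ContinuousAt (fun ρ : ℝ => 8 * (N : ℝ) * (1 - ρ)) 1 := by fun_prop
      exact nhdsWithin_le_nhds (this.eventually (gt_mem_nhds (by simp)))
    have k4 : ∀ᶠ ρ : ℝ in 𝓝[<] 1, lam * (1 - ρ ^ 2) < 2 * N := by
      have : ContinuousAt (fun ρ : ℝ => lam * (1 - ρ ^ 2)) 1 := by fun_prop
      refine nhdsWithin_le_nhds (this.eventually (gt_mem_nhds ?_))
      simp; linarith
    have k5 : ∀ᶠ ρ : ℝ in 𝓝[<] 1, ra < ρ := nhdsWithin_le_nhds (lt_mem_nhds hra)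
    have k6 : ∀ᶠ ρ : ℝ in 𝓝[<] 1, rb < ρ := nhdsWithin_le_nhds (lt_mem_nhds hrb)
    obtain ⟨ρ, h1, h2, h3, h4, h5, h6⟩ := (k1.and (k2.and (k3.and (k4.and (k5.and k6))))).exists
    exact ⟨ρ, h1.le, h2, h3.le, h4, h5, h6⟩
  obtain ⟨m, hm⟩ := blow_bddBelow hu₁
  obtain ⟨M, hM⟩ := blow_bddAbove hu₂ (r := ρ) (by linarith) h2
  have hρs : 0 < 1 - ρ ^ 2 := by nlinarith
  refine ⟨ρ, max 0 ((M - m) / (1 - ρ ^ 2)), h2, le_max_left _ _, fun x hx hx1 => ?_⟩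
  set C := max 0 ((M - m) / (1 - ρ ^ 2)) with hC
  have hCb : M - m ≤ C * (1 - ρ ^ 2) := by
    rw [← div_le_iff₀ hρs]; exact le_max_right _ _
  have hxp : 0 < ‖x‖ := by linarith
  set h := 1 - 4 * N * (‖x‖ - ρ) ^ 2 with hh
  have ht : Tendsto (fun e : ℝ => u₂ x - u₁ ((1 + e * (h / ‖x‖)) • x)) (𝓝[>] 0)
      (𝓝 (u₂ x - u₁ x)) := by
    refine tendsto_const_nhds.sub ?_
    have c1 : ContinuousAt u₁ x := (contDiffAt_of_ball hu₁.1 hx1).continuousAt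
    have c2 : Tendsto (fun e : ℝ => (1 + e * (h / ‖x‖)) • x) (𝓝[>] 0) (𝓝 x) := by
      have : ContinuousAt (fun e : ℝ => (1 + e * (h / ‖x‖)) • x) 0 := by fun_prop
      have := this.tendsto
      simp only [zero_mul, add_zero, one_smul] at this
      exact this.mono_left nhdsWithin_le_nhds
    exact c1.tendsto.comp c2
  refine le_of_tendsto ht ?_
  have k1 : ∀ᶠ e : ℝ in 𝓝[>] 0, 0 < e := self_mem_nhdsWithin
  have k2 : ∀ᶠ e : ℝ in 𝓝[>] 0, e < 1 := nhdsWithin_le_nhds (gt_mem_nhds (by norm_num))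
  have k3 : ∀ᶠ e : ℝ in 𝓝[>] 0, ‖x‖ + e < 1 := by
    have : ContinuousAt (fun e : ℝ => ‖x‖ + e) 0 := by fun_prop
    exact nhdsWithin_le_nhds (this.eventually (gt_mem_nhds (by simpa using hx1)))
  filter_upwards [k1, k2, k3] with e he he1 he2
  obtain ⟨b1, b2, -⟩ := g_bracket hNr h1 hx hx1.le h3 he he1.le
  rw [← hh] at b1 b2
  have hn : ‖(1 + e * (h / ‖x‖)) • x‖ = ‖x‖ + e * h := by
    have : 0 ≤ 1 + e * (h / ‖x‖) := by
      have h0 : 0 < h := by nlinarith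
      positivity
    rw [norm_smul, Real.norm_eq_abs, abs_of_nonneg this]
    field_simp
  exact step1 hN hf0 hlam hmono hu₁ hu₂ h1 h2 h3 h4
    (fun y hy hy1 => hra' y (by linarith) hy1) (fun y hy hy1 => hrb' y (by linarith) hy1)
    (le_max_left _ _) (fun x hx y hy => by
      have := hm y hy
      have := hM x hx.le
      linarith) he he1.le hx hx1.le hn (by rw [hn]; linarith)

lemma lap_v {f : ℝ → ℝ} {lam k : ℝ} {φ u₁ u₂ : EuclideanSpace ℝ (Fin N) → ℝ}
    (hφreg : ContDiffOn ℝ 2 φ (ball 0 1))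
    (hφeq : ∀ x ∈ ball (0 : EuclideanSpace ℝ (Fin N)) 1, lap φ x = -lam * φ x)
    (hu₁ : IsBlowUp f u₁) (hu₂ : IsBlowUp f u₂) {x : EuclideanSpace ℝ (Fin N)} (hx : ‖x‖ < 1) :
    lap (fun y => (u₁ y - 1 * u₂ y) - k * φ y) x = f (u₁ x) - f (u₂ x) + k * lam * φ x := by
  have hx' : x ∈ ball (0 : EuclideanSpace ℝ (Fin N)) 1 := by simpa using hx
  have c1 := contDiffAt_of_ball hu₁.1 hx
  have c2 := contDiffAt_of_ball hu₂.1 hx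
  have c3 := contDiffAt_of_ball hφreg hx
  rw [lap_comb (u := fun y => u₁ y - 1 * u₂ y) (c1.sub (contDiffAt_const.mul c2)) c3 k,
    lap_comb c1 c2, hu₁.2.1 x hx', hu₂.2.1 x hx', hφeq x hx']
  ring

lemma cd_v {f : ℝ → ℝ} {k : ℝ} {φ u₁ u₂ : EuclideanSpace ℝ (Fin N) → ℝ}
    (hφreg : ContDiffOn ℝ 2 φ (ball 0 1))
    (hu₁ : IsBlowUp f u₁) (hu₂ : IsBlowUp f u₂) :
    ContDiffOn ℝ 2 (fun y => (u₁ y - 1 * u₂ y) - k * φ y) (ball 0 1) :=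
  (hu₁.1.sub (contDiffOn_const.mul hu₂.1)).sub (contDiffOn_const.mul hφreg)

lemma annulus {f : ℝ → ℝ} {a : ℝ} (hN : 1 ≤ N) (hf0 : ∀ t > a, 0 ≤ f t) {lam : ℝ} (hlam : 0 < lam)
    (hmono : Monotone fun t => f t + lam * t)
    {φ u₁ u₂ : EuclideanSpace ℝ (Fin N) → ℝ}
    (hφreg : ContDiffOn ℝ 2 φ (ball 0 1))
    (hφpos : ∀ x ∈ ball (0 : EuclideanSpace ℝ (Fin N)) 1, 0 < φ x)
    (hφeq : ∀ x ∈ ball (0 : EuclideanSpace ℝ (Fin N)) 1, lap φ x = -lam * φ x)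
    (hu₁ : IsBlowUp f u₁) (hu₂ : IsBlowUp f u₂)
    {ρ : ℝ} (hρ : 0 < ρ) (hl : lam * (1 - ρ ^ 2) < N) {k : ℝ} (hk : 0 ≤ k)
    (hb : ∀ x, ‖x‖ = ρ → u₁ x - u₂ x ≤ k * φ x)
    {xx : EuclideanSpace ℝ (Fin N)} (hxx : ρ ≤ ‖xx‖) (hxx1 : ‖xx‖ < 1) :
    u₁ xx - u₂ xx ≤ k * φ xx := by
  have hNr : (1:ℝ) ≤ N := by exact_mod_cast hN
  by_contra hcon
  push Not at hcon
  obtain ⟨ρ', C, hρ', hC, hbd⟩ := step1b hN hf0 hlam hmono hu₂ hu₁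
  set δ : ℝ := N / lam with hδ
  have hδ0 : 0 < δ := by positivity
  have hψ : ∀ x : EuclideanSpace ℝ (Fin N), ‖x‖ < 1 → δ < 1 + δ - ‖x‖ ^ 2 := by
    intro x hx
    nlinarith [norm_nonneg x]
  set v : EuclideanSpace ℝ (Fin N) → ℝ := fun y => (u₁ y - 1 * u₂ y) - k * φ y with hv
  have hvx : 0 < v xx := by simp only [hv]; linarith
  set D := v xx / (1 + δ - ‖xx‖ ^ 2) with hD
  have hD0 : 0 < D := div_pos hvx (by have := hψ xx hxx1; linarith)
  -- near the boundary
  obtain ⟨r2, hr2a, hr2b, hr2c, hr2d⟩ : ∃ r : ℝ, ρ' < r ∧ ‖xx‖ < r ∧ r < 1 ∧ C * (1 - r ^ 2) < D * δ := by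
    have k1 : ∀ᶠ r : ℝ in 𝓝[<] 1, ρ' < r := nhdsWithin_le_nhds (lt_mem_nhds hρ')
    have k2 : ∀ᶠ r : ℝ in 𝓝[<] 1, ‖xx‖ < r := nhdsWithin_le_nhds (lt_mem_nhds hxx1)
    have k3 : ∀ᶠ r : ℝ in 𝓝[<] 1, r < 1 := self_mem_nhdsWithin
    have k4 : ∀ᶠ r : ℝ in 𝓝[<] 1, C * (1 - r ^ 2) < D * δ := by
      have : ContinuousAt (fun r : ℝ => C * (1 - r ^ 2)) 1 := by fun_prop
      refine nhdsWithin_le_nhds (this.eventually (gt_mem_nhds ?_))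
      simp; positivity
    obtain ⟨r, h1, h2, h3, h4⟩ := (k1.and (k2.and (k3.and k4))).exists
    exact ⟨r, h1, h2, h3, h4⟩
  let K : Set (EuclideanSpace ℝ (Fin N)) := {x | ρ ≤ ‖x‖} ∩ closedBall 0 r2
  have hK : IsCompact K := (isCompact_closedBall 0 r2).inter_left
    (isClosed_le continuous_const continuous_norm)
  have hK1 : ∀ x ∈ K, ρ ≤ ‖x‖ ∧ ‖x‖ ≤ r2 := fun x hx => ⟨hx.1, by simpa using hx.2⟩
  have hK2 : ∀ x, ρ ≤ ‖x‖ → ‖x‖ ≤ r2 → x ∈ K := fun x h1 h2 => ⟨h1, by simpa using h2⟩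
  have hcd := cd_v (k := k) hφreg hu₁ hu₂
  obtain ⟨x0, hx0, hmax⟩ := hK.exists_isMaxOn ⟨xx, hK2 xx hxx hr2b.le⟩
    (f := fun x => v x / (1 + δ - ‖x‖ ^ 2)) (by
      refine ContinuousOn.div (hcd.continuousOn.mono fun x hx => ?_) (by fun_prop) fun x hx => ?_
      · have := (hK1 x hx).2
        simp; linarith
      · have := hψ x (by have := (hK1 x hx).2; linarith)
        linarith)
  obtain ⟨h1, h2⟩ := hK1 x0 hx0
  have hx01 : ‖x0‖ < 1 := by linarith
  set C1 := v x0 / (1 + δ - ‖x0‖ ^ 2) with hC1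
  have hDC : D ≤ C1 := hmax (hK2 xx hxx hr2b.le)
  have hψ0 := hψ x0 hx01
  have heq : v x0 = C1 * (1 + δ - ‖x0‖ ^ 2) := by
    rw [hC1, div_mul_cancel₀]; linarith
  have hmax' : ∀ x ∈ K, v x ≤ C1 * (1 + δ - ‖x‖ ^ 2) := by
    intro x hx
    have h3 : v x / (1 + δ - ‖x‖ ^ 2) ≤ C1 := hmax hx
    have := hψ x (by have := (hK1 x hx).2; linarith)
    rwa [div_le_iff₀ (by linarith)] at h3
  clear_value C1
  have hC1p : 0 < C1 := by linarith
  have hv0 : 0 < v x0 := by rw [heq]; apply mul_pos hC1p; linarith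
  have hφ0 := hφpos x0 (by simpa using hx01)
  have h1' : ρ < ‖x0‖ := by
    refine lt_of_le_of_ne h1 fun h => ?_
    have := hb x0 h.symm
    simp only [hv] at hv0
    linarith
  have h2' : ‖x0‖ < r2 := by
    refine lt_of_le_of_ne h2 fun h => ?_
    have h3 := hbd x0 (by linarith) hx01
    rw [h] at h3
    have h4 : v x0 ≤ u₁ x0 - u₂ x0 := by
      simp only [hv]
      have : 0 ≤ k * φ x0 := by positivity
      linarith
    have h5 : D * δ ≤ C1 * (1 + δ - ‖x0‖ ^ 2) := by gcongr
    linarith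
  have hloc : IsLocalMax (fun y => v y + C1 * ‖y‖ ^ 2) x0 := by
    have n1 : ∀ᶠ y in 𝓝 x0, ρ < ‖y‖ := continuous_norm.continuousAt.eventually (lt_mem_nhds h1')
    have n2 : ∀ᶠ y in 𝓝 x0, ‖y‖ < r2 := continuous_norm.continuousAt.eventually (gt_mem_nhds h2')
    filter_upwards [n1, n2] with y hy1 hy2
    have := hmax' y (hK2 y hy1.le hy2.le)
    nlinarith
  have := lap_max_test (contDiffAt_of_ball hcd hx01) (q := fun y => C1 * ‖y‖ ^ 2)
    (l := fun w => C1 * (2 * inner ℝ x0 w)) (m := fun w => C1 * ‖w‖ ^ 2)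
    (fun w s => by rw [normsq_line]; ring) hloc
  rw [lap_v hφreg hφeq hu₁ hu₂ hx01] at this
  simp at this
  have hkφ : 0 ≤ k * φ x0 := by positivity
  have hm : f (u₂ x0) + lam * u₂ x0 ≤ f (u₁ x0) + lam * u₁ x0 := by
    apply hmono
    simp only [hv] at hv0
    linarith
  simp only [hv] at heq
  have e1 : lam * δ = N := by rw [hδ]; field_simp
  have e2 : lam * (1 + δ - ‖x0‖ ^ 2) < 2 * N := by
    have : lam * (1 - ‖x0‖ ^ 2) ≤ lam * (1 - ρ ^ 2) := by gcongr
    nlinarith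
  have e3 : lam * (u₁ x0 - u₂ x0 - k * φ x0) < 2 * N * C1 := by
    have : u₁ x0 - u₂ x0 - k * φ x0 = C1 * (1 + δ - ‖x0‖ ^ 2) := by linarith
    rw [this]
    have := mul_lt_mul_of_pos_left e2 hC1p
    linarith
  have e4 : lam * (u₁ x0 - u₂ x0 - k * φ x0) = lam * u₁ x0 - lam * u₂ x0 - k * lam * φ x0 := by ring
  clear hmax' hmax hcon hψ heq hvx
  linarith
end

section
variable {N : ℕ}

lemma sum_inner_sq (e : EuclideanSpace ℝ (Fin N)) :
    ∑ i, (inner ℝ e (EuclideanSpace.single i (1:ℝ))) ^ 2 = ‖e‖ ^ 2 := by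
  rw [EuclideanSpace.norm_sq_eq]
  refine Finset.sum_congr rfl fun i _ => ?_
  simp [EuclideanSpace.inner_single_right]

/-- Hopf-type contradiction. -/
lemma hopf_contra {v : EuclideanSpace ℝ (Fin N) → ℝ} (hN : 1 ≤ N) (hv : ContDiffOn ℝ 2 v (ball 0 1))
    {x1 e : EuclideanSpace ℝ (Fin N)} {R s : ℝ} (he : ‖e‖ = 1) (hR : 0 < R) (hs : 0 < s)
    (hv1 : v x1 = 0) (hle : ∀ x, ‖x‖ < 1 → v x ≤ 0)
    (hsub : ∀ x, ‖x - x1‖ ≤ s → ‖x‖ < 1)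
    (hlap : ∀ x, ‖x - x1‖ ≤ s → 0 ≤ lap v x)
    (hneg : ∀ x, ‖x - (x1 + R • e)‖ < R → v x < 0)
    (hAs : (N * (2 / R) + 1) * s ≤ 1) : False := by
  have hNr : (1:ℝ) ≤ N := by exact_mod_cast hN
  obtain ⟨B, hB⟩ : ∃ B, B = 2 / R := ⟨_, rfl⟩
  obtain ⟨A, hA⟩ : ∃ A : ℝ, A = N * B + 1 := ⟨_, rfl⟩
  have hBR : B * R = 2 := by rw [hB]; field_simp
  have hBp : 0 < B := by rw [hB]; positivity
  have hAp : 0 < A := by rw [hA]; positivity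
  rw [← hB, ← hA] at hAs
  obtain ⟨b, hb⟩ : ∃ b : EuclideanSpace ℝ (Fin N) → ℝ, ∀ x, b x =
    inner ℝ e (x - x1) + A * (inner ℝ e (x - x1)) ^ 2 - B * ‖x - x1‖ ^ 2 := ⟨_, fun _ => rfl⟩
  have hbc : Continuous b := by
    have : b = fun x => inner ℝ e (x - x1) + A * (inner ℝ e (x - x1)) ^ 2 - B * ‖x - x1‖ ^ 2 :=
      funext hb
    rw [this]; fun_prop
  have hb1 : b x1 = 0 := by rw [hb]; simp
  have hvc : ContinuousOn v (closedBall x1 s) := hv.continuousOn.mono fun x hx => by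
    rw [mem_ball_zero_iff]; exact hsub x (by rwa [mem_closedBall, dist_eq_norm] at hx)
  -- sphere negativity
  have key : ∀ x, ‖x - x1‖ = s → 0 ≤ b x → v x < 0 := by
    intro x hx hbx
    apply hneg
    rw [hb, hx] at hbx
    have hip : |inner ℝ e (x - x1)| ≤ s := by
      have := abs_real_inner_le_norm e (x - x1)
      rwa [he, hx, one_mul] at this
    obtain ⟨p, hp⟩ : ∃ p, p = inner ℝ e (x - x1) := ⟨_, rfl⟩
    rw [← hp] at hbx hip
    obtain ⟨hp1, hp2⟩ := abs_le.1 hip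
    have hApp : A * p ^ 2 ≤ |p| := by
      rw [← sq_abs]
      have h0 := abs_nonneg p
      have : A * |p| ≤ 1 := le_trans (by gcongr) hAs
      nlinarith
    have hsp : 0 < B * s ^ 2 := by positivity
    have hpp : 0 < p := by
      by_contra h
      push Not at h
      rw [abs_of_nonpos h] at hApp
      linarith
    rw [abs_of_pos hpp] at hApp
    have h2 : s ^ 2 ≤ R * p := by
      have h3 : B * s ^ 2 ≤ 2 * p := by linarith
      have := mul_le_mul_of_nonneg_left h3 hR.le
      nlinarith
    have h4 : ‖x - (x1 + R • e)‖ ^ 2 = s ^ 2 - 2 * R * p + R ^ 2 := by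
      have : x - (x1 + R • e) = (x - x1) - R • e := by abel
      rw [this, norm_sub_sq_real, inner_smul_right, real_inner_comm, ← hp, hx, norm_smul, he,
        mul_one, Real.norm_eq_abs, sq_abs]
      ring
    have h5 : 0 < R * p := by positivity
    exact lt_of_pow_lt_pow_left₀ 2 hR.le (by rw [h4]; linarith)
  obtain ⟨ε, hε, hεs⟩ : ∃ ε > 0, ∀ x, ‖x - x1‖ = s → v x + ε * b x < 0 := by
    obtain ⟨S, hS⟩ : ∃ S : Set (EuclideanSpace ℝ (Fin N)), S = {x | ‖x - x1‖ = s ∧ 0 ≤ b x} :=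
      ⟨_, rfl⟩
    have hSm : ∀ x, x ∈ S ↔ (‖x - x1‖ = s ∧ 0 ≤ b x) := by intro x; rw [hS]; exact Iff.rfl
    have hSc : IsCompact S := by
      refine (isCompact_closedBall x1 s).of_isClosed_subset ?_ ?_
      · rw [hS]
        exact (isClosed_eq (by fun_prop) (by fun_prop)).inter (isClosed_le (by fun_prop) hbc)
      · intro x hx
        rw [mem_closedBall, dist_eq_norm]; exact ((hSm x).1 hx).1.le
    have hSsub : S ⊆ closedBall x1 s := by
      intro x hx
      rw [mem_closedBall, dist_eq_norm]; exact ((hSm x).1 hx).1.le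
    have hbub : ∀ x, ‖x - x1‖ = s → b x ≤ s + A * s ^ 2 := by
      intro x hx
      rw [hb, hx]
      have hip : |inner ℝ e (x - x1)| ≤ s := by
        have := abs_real_inner_le_norm e (x - x1)
        rwa [he, hx, one_mul] at this
      have h1 := (abs_le.1 hip).2
      have h2 : (inner ℝ e (x - x1)) ^ 2 ≤ s ^ 2 := sq_le_sq' (abs_le.1 hip).1 h1
      have h3 := mul_le_mul_of_nonneg_left h2 hAp.le
      have : 0 < B * s ^ 2 := by positivity
      linarith
    have hDp : 0 < s + A * s ^ 2 := by positivity
    rcases S.eq_empty_or_nonempty with hE | hE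
    · refine ⟨1, one_pos, fun x hx => ?_⟩
      have h1 : ¬ 0 ≤ b x := fun h => by
        have := (hSm x).2 ⟨hx, h⟩
        rw [hE] at this; exact this
      have h2 := hle x (hsub x hx.le)
      push Not at h1
      linarith
    · obtain ⟨z, hz, hzm⟩ := hSc.exists_isMaxOn hE (hvc.mono hSsub)
      have hvz : v z < 0 := key z ((hSm z).1 hz).1 ((hSm z).1 hz).2
      refine ⟨-v z / (2 * (s + A * s ^ 2)), div_pos (by linarith) (by positivity), fun x hx => ?_⟩
      have hεp : 0 < -v z / (2 * (s + A * s ^ 2)) := div_pos (by linarith) (by positivity)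
      by_cases h : 0 ≤ b x
      · have h1 : v x ≤ v z := hzm ((hSm x).2 ⟨hx, h⟩)
        have h2 := mul_le_mul_of_nonneg_left (hbub x hx) hεp.le
        have h3 : -v z / (2 * (s + A * s ^ 2)) * (s + A * s ^ 2) = -v z / 2 := by field_simp
        linarith
      · push Not at h
        have h2 := hle x (hsub x hx.le)
        have := mul_neg_of_pos_of_neg hεp h
        linarith
  obtain ⟨z, hz, hzm⟩ := (isCompact_closedBall x1 s).exists_isMaxOn
    ⟨x1, mem_closedBall_self hs.le⟩ (hvc.add (hbc.const_smul ε).continuousOn)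
  have hzm' : ∀ x, ‖x - x1‖ ≤ s → v x + ε * b x ≤ v z + ε * b z := fun x hx =>
    hzm (by rw [mem_closedBall, dist_eq_norm]; exact hx)
  rw [mem_closedBall, dist_eq_norm] at hz
  have hz0 := hzm' x1 (by simpa using hs.le)
  rw [hv1, hb1] at hz0
  have hzlt : ‖z - x1‖ < s := by
    refine lt_of_le_of_ne hz fun h => ?_
    have := hεs z h
    linarith
  have hz1 := hsub z hz
  have T := lap_max_test (contDiffAt_of_ball hv hz1) (q := fun y => ε * b y)
    (l := fun w => ε * (inner ℝ e w + 2 * A * inner ℝ e (z - x1) * inner ℝ e w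
      - 2 * B * inner ℝ (z - x1) w))
    (m := fun w => ε * (A * (inner ℝ e w) ^ 2 - B * ‖w‖ ^ 2))
    (by
      intro w t
      have h1 : z + t • w - x1 = (z - x1) + t • w := by abel
      simp only [hb]
      rw [h1, normsq_line, inner_add_right, inner_smul_right]
      ring)
    (by
      have : ball x1 s ∈ 𝓝 z := isOpen_ball.mem_nhds (by rwa [mem_ball, dist_eq_norm])
      filter_upwards [this] with y hy
      exact hzm' y (by rw [mem_ball, dist_eq_norm] at hy; exact hy.le))
  have hsum : ∑ i : Fin N, 2 * (ε * (A * (inner ℝ e (EuclideanSpace.single i (1:ℝ))) ^ 2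
      - B * ‖EuclideanSpace.single i (1:ℝ)‖ ^ 2)) = 2 * ε * (A - N * B) := by
    have : ∀ i : Fin N, 2 * (ε * (A * (inner ℝ e (EuclideanSpace.single i (1:ℝ))) ^ 2
      - B * ‖EuclideanSpace.single i (1:ℝ)‖ ^ 2)) =
      2 * ε * A * (inner ℝ e (EuclideanSpace.single i (1:ℝ))) ^ 2 - 2 * ε * B := by
      intro i
      rw [EuclideanSpace.norm_single]; simp; ring
    rw [Finset.sum_congr rfl fun i _ => this i, Finset.sum_sub_distrib, ← Finset.mul_sum,
      sum_inner_sq, he]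
    simp; ring
  have hl := hlap z hz
  have : lap v z + 2 * ε * (A - N * B) ≤ 0 := by rw [← hsum]; exact T
  rw [hA] at this
  linarith

lemma strongMP (hN : 1 ≤ N) {v : EuclideanSpace ℝ (Fin N) → ℝ} (hv : ContDiffOn ℝ 2 v (ball 0 1))
    (hle : ∀ x, ‖x‖ < 1 → v x ≤ 0)
    (hlap : ∀ x, ‖x‖ < 1 → v x = 0 → ∀ᶠ y in 𝓝 x, 0 ≤ lap v y)
    {x0 : EuclideanSpace ℝ (Fin N)} (hx0 : ‖x0‖ < 1) (hv0 : v x0 = 0) :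
    ∀ x, ‖x‖ < 1 → v x = 0 := by
  -- zero set open
  have hop : ∀ x, ‖x‖ < 1 → v x = 0 → ∀ᶠ y in 𝓝 x, v y = 0 := by
    intro xs hxs hvs
    by_contra hcon
    obtain ⟨d, hd⟩ : ∃ d, d = 1 - ‖xs‖ := ⟨_, rfl⟩
    have hdp : 0 < d := by linarith
    have hin : ∀ x, ‖x - xs‖ < d → ‖x‖ < 1 := by
      intro x hx
      have := norm_add_le (x - xs) xs
      rw [sub_add_cancel] at this
      linarith
    obtain ⟨y, hy, hvy⟩ : ∃ y, ‖y - xs‖ < d / 4 ∧ v y ≠ 0 := by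
      by_contra h
      push Not at h
      apply hcon
      filter_upwards [ball_mem_nhds xs (by linarith : 0 < d / 4)] with y hy
      exact h y (by rwa [mem_ball, dist_eq_norm] at hy)
    obtain ⟨S, hS⟩ : ∃ S : Set (EuclideanSpace ℝ (Fin N)),
      S = closedBall xs (d / 2) ∩ v ⁻¹' {0} := ⟨_, rfl⟩
    have hSm : ∀ x, x ∈ S ↔ (‖x - xs‖ ≤ d / 2 ∧ v x = 0) := by
      intro x; rw [hS]; simp [dist_eq_norm]
    have hvc : ContinuousOn v (closedBall xs (d / 2)) := hv.continuousOn.mono fun x hx => by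
      rw [mem_ball_zero_iff]
      rw [mem_closedBall, dist_eq_norm] at hx
      exact hin x (by linarith)
    have hSc : IsCompact S := by
      refine (isCompact_closedBall xs (d / 2)).of_isClosed_subset ?_ ?_
      · rw [hS]; exact hvc.preimage_isClosed_of_isClosed isClosed_closedBall isClosed_singleton
      · rw [hS]; exact inter_subset_left
    obtain ⟨x1, hx1, hmin⟩ := hSc.exists_isMinOn (f := fun x => ‖x - y‖)
      ⟨xs, (hSm xs).2 ⟨by simpa using by linarith, hvs⟩⟩ (by fun_prop)
    have hmin' : ∀ x ∈ S, ‖x1 - y‖ ≤ ‖x - y‖ := fun x hx => hmin hx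
    obtain ⟨hx1d, hvx1⟩ := (hSm x1).1 hx1
    have hx1b := hin x1 (by linarith)
    obtain ⟨R, hR⟩ : ∃ R, R = ‖x1 - y‖ := ⟨_, rfl⟩
    have hRp : 0 < R := by
      rw [hR, norm_pos_iff, sub_ne_zero]
      rintro rfl
      exact hvy hvx1
    have hRlt : R < d / 4 := by
      have := hmin' xs ((hSm xs).2 ⟨by simpa using by linarith, hvs⟩)
      rw [norm_sub_rev xs y] at this
      linarith
    have hev := hlap x1 hx1b hvx1
    obtain ⟨s1, hs1, hs1b⟩ := Metric.eventually_nhds_iff.1 hev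
    have hNp : (0:ℝ) < N * (2 / R) + 1 := by positivity
    obtain ⟨s, hs, h1, h2, h3⟩ : ∃ s > 0, s < s1 ∧ s < 1 - ‖x1‖ ∧ s < 1 / (N * (2 / R) + 1) := by
      have := lt_min hs1 (lt_min (by linarith : 0 < 1 - ‖x1‖) (one_div_pos.2 hNp))
      obtain ⟨s, h1, h2⟩ := exists_between this
      rw [lt_min_iff, lt_min_iff] at h2
      exact ⟨s, h1, h2.1, h2.2.1, h2.2.2⟩
    refine hopf_contra hN hv (x1 := x1) (e := R⁻¹ • (y - x1)) (R := R) (s := s) ?_ hRp hs hvx1 hle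
      ?_ ?_ ?_ ?_
    · rw [norm_smul, norm_sub_rev, ← hR, Real.norm_eq_abs, abs_of_pos (by positivity)]
      field_simp
    · intro x hx
      have := norm_add_le (x - x1) x1
      rw [sub_add_cancel] at this
      linarith
    · intro x hx
      exact hs1b (by rw [dist_eq_norm]; linarith)
    · intro x hx
      rw [smul_smul, mul_inv_cancel₀ hRp.ne', one_smul, add_sub_cancel] at hx
      have hxd : ‖x - xs‖ ≤ d / 2 := by
        have := norm_add_le (x - y) (y - xs)
        rw [sub_add_sub_cancel] at this
        linarith
      refine lt_of_le_of_ne (hle x (hin x (by linarith))) fun h => ?_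
      have := hmin' x ((hSm x).2 ⟨hxd, h⟩)
      linarith
    · rw [lt_div_iff₀ hNp] at h3
      linarith
  have hpre : IsPreconnected (ball (0 : EuclideanSpace ℝ (Fin N)) 1) :=
    (convex_ball _ _).isPreconnected
  by_contra hcon
  push Not at hcon
  obtain ⟨z, hz, hvz⟩ := hcon
  have hU : IsOpen {x : EuclideanSpace ℝ (Fin N) | ‖x‖ < 1 ∧ v x = 0} := by
    rw [isOpen_iff_mem_nhds]
    rintro x ⟨h1, h2⟩
    filter_upwards [hop x h1 h2, isOpen_ball.mem_nhds (mem_ball_zero_iff.2 h1)] with y h3 h4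
    exact ⟨mem_ball_zero_iff.1 h4, h3⟩
  have hV : IsOpen {x : EuclideanSpace ℝ (Fin N) | ‖x‖ < 1 ∧ v x ≠ 0} := by
    rw [isOpen_iff_mem_nhds]
    rintro x ⟨h1, h2⟩
    filter_upwards [(contDiffAt_of_ball hv h1).continuousAt.eventually_ne h2,
      isOpen_ball.mem_nhds (mem_ball_zero_iff.2 h1)] with y h3 h4
    exact ⟨mem_ball_zero_iff.1 h4, h3⟩
  obtain ⟨w, hw, hw1, hw2⟩ := hpre _ _ hU hV
    (fun x hx => by
      have h1 := mem_ball_zero_iff.1 hx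
      by_cases h : v x = 0
      · exact Or.inl ⟨h1, h⟩
      · exact Or.inr ⟨h1, h⟩)
    ⟨x0, mem_ball_zero_iff.2 hx0, hx0, hv0⟩ ⟨z, mem_ball_zero_iff.2 hz, hz, hvz⟩
  exact hw2.2 hw1.2
end
section
variable {N : ℕ}

/-- G constant on each `[u₂ x, u₁ x]` is impossible. -/
lemma const_contra {f : ℝ → ℝ} {a : ℝ} (hN : 1 ≤ N) (hfc : Continuous f) (hf0 : ∀ t > a, 0 ≤ f t)
    {lam : ℝ} (hlam : 0 < lam) (hmono : Monotone fun t => f t + lam * t)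
    {u₁ u₂ : EuclideanSpace ℝ (Fin N) → ℝ} (hu₂ : IsBlowUp f u₂)
    (hlt : ∀ x, ‖x‖ < 1 → u₂ x < u₁ x)
    (heq : ∀ x, ‖x‖ < 1 → f (u₁ x) + lam * u₁ x = f (u₂ x) + lam * u₂ x) : False := by
  obtain ⟨t0, ht0⟩ : ∃ t0, t0 = u₂ 0 := ⟨_, rfl⟩
  obtain ⟨c, hc⟩ : ∃ c, c = f t0 + lam * t0 := ⟨_, rfl⟩
  obtain ⟨T, hTa, hTt, hTc⟩ : ∃ T, a < T ∧ t0 < T ∧ c / lam < T := by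
    refine ⟨max a (max t0 (c / lam)) + 1, ?_, ?_, ?_⟩
    · have := le_max_left a (max t0 (c / lam)); linarith
    · have := le_max_right a (max t0 (c / lam))
      have := le_max_left t0 (c / lam); linarith
    · have := le_max_right a (max t0 (c / lam))
      have := le_max_right t0 (c / lam); linarith
  have hGT : c < f T + lam * T := by
    rw [div_lt_iff₀ hlam] at hTc
    have := hf0 T hTa
    linarith
  obtain ⟨S, hS⟩ : ∃ S : Set ℝ, S = Icc t0 T ∩ {t | f t + lam * t ≤ c} := ⟨_, rfl⟩
  have hSm : ∀ t, t ∈ S ↔ ((t0 ≤ t ∧ t ≤ T) ∧ f t + lam * t ≤ c) := by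
    intro t; rw [hS]; exact Iff.rfl
  have hSc : IsCompact S := by
    rw [hS]
    exact isCompact_Icc.inter_right (isClosed_le (by fun_prop) (by fun_prop))
  obtain ⟨ts, hts, hmax⟩ := hSc.exists_isMaxOn (f := fun t => t)
    ⟨t0, (hSm t0).2 ⟨⟨le_rfl, hTt.le⟩, hc.ge⟩⟩ (by fun_prop)
  have hmax' : ∀ t ∈ S, t ≤ ts := fun t ht => hmax ht
  obtain ⟨⟨h1, h2⟩, h3⟩ := (hSm ts).1 hts
  -- find x with u₂ x = ts
  obtain ⟨r, hr0, hr1, hr⟩ := unif_blow hu₂.2.2 ts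
  obtain ⟨z, hz⟩ : ∃ z : EuclideanSpace ℝ (Fin N), ‖z‖ = (r + 1) / 2 :=
    ⟨((r + 1) / 2) • EuclideanSpace.single ⟨0, hN⟩ (1:ℝ), by
      rw [norm_smul, Real.norm_eq_abs, abs_of_pos (by linarith)]; simp⟩
  have hzt := hr z (by rw [hz]; linarith) (by rw [hz]; linarith)
  have hpre : IsPreconnected (ball (0 : EuclideanSpace ℝ (Fin N)) 1) :=
    (convex_ball _ _).isPreconnected
  obtain ⟨x, hx, hxt⟩ := hpre.intermediate_value (a := 0) (b := z) (by simp)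
    (by rw [mem_ball_zero_iff, hz]; linarith) hu₂.1.continuousOn
    ⟨by rw [← ht0]; exact h1, hzt.le⟩
  rw [mem_ball_zero_iff] at hx
  have hl := hlt x hx
  have he := heq x hx
  rw [hxt] at hl he
  by_cases hT : u₁ x ≤ T
  · have := hmax' (u₁ x) ((hSm _).2 ⟨⟨by linarith, hT⟩, by linarith⟩)
    linarith
  · push Not at hT
    have := hmono hT.le
    simp only at this
    linarith

lemma main_le {f : ℝ → ℝ} {a : ℝ} (hN : 1 ≤ N) (hfc : Continuous f) (hf0 : ∀ t > a, 0 ≤ f t)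
    {lam : ℝ} (hlam : 0 < lam) (hmono : Monotone fun t => f t + lam * t)
    {φ u₁ u₂ : EuclideanSpace ℝ (Fin N) → ℝ}
    (hφreg : ContDiffOn ℝ 2 φ (ball 0 1))
    (hφpos : ∀ x ∈ ball (0 : EuclideanSpace ℝ (Fin N)) 1, 0 < φ x)
    (hφeq : ∀ x ∈ ball (0 : EuclideanSpace ℝ (Fin N)) 1, lap φ x = -lam * φ x)
    (hu₁ : IsBlowUp f u₁) (hu₂ : IsBlowUp f u₂) {xx : EuclideanSpace ℝ (Fin N)} (hxx : ‖xx‖ < 1) :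
    u₁ xx ≤ u₂ xx := by
  have hNr : (1:ℝ) ≤ N := by exact_mod_cast hN
  have hφp : ∀ x, ‖x‖ < 1 → 0 < φ x := fun x hx => hφpos x (mem_ball_zero_iff.2 hx)
  obtain ⟨ρ, hρ, hρ1, hl⟩ : ∃ ρ : ℝ, 0 < ρ ∧ ρ < 1 ∧ lam * (1 - ρ ^ 2) < N := by
    have hc : ContinuousAt (fun r : ℝ => lam * (1 - r ^ 2)) 1 := by fun_prop
    have h1 : ∀ᶠ r : ℝ in 𝓝[<] 1, lam * (1 - r ^ 2) < N :=
      (hc.eventually (gt_mem_nhds (by simp; linarith))).filter_mono nhdsWithin_le_nhds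
    have h2 : ∀ᶠ r : ℝ in 𝓝[<] 1, r ∈ Ioo (0:ℝ) 1 := Ioo_mem_nhdsLT one_pos
    obtain ⟨r, h3, h4⟩ := (h1.and h2).exists
    exact ⟨r, h4.1, h4.2, h3⟩
  have hin : ∀ x : EuclideanSpace ℝ (Fin N), x ∈ closedBall 0 ρ → ‖x‖ < 1 := by
    intro x hx
    rw [mem_closedBall_zero_iff] at hx
    linarith
  have hsub : closedBall (0 : EuclideanSpace ℝ (Fin N)) ρ ⊆ ball 0 1 := fun x hx =>
    mem_ball_zero_iff.2 (hin x hx)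
  obtain ⟨z, hz, hzm⟩ := (isCompact_closedBall (0 : EuclideanSpace ℝ (Fin N)) ρ).exists_isMaxOn
    (f := fun x => (u₁ x - u₂ x) / φ x) ⟨0, mem_closedBall_self hρ.le⟩
    (((hu₁.1.continuousOn.mono hsub).sub (hu₂.1.continuousOn.mono hsub)).div
      (hφreg.continuousOn.mono hsub) fun x hx => (hφp x (hin x hx)).ne')
  have hz1 := hin z hz
  obtain ⟨k, hk⟩ : ∃ k, k = (u₁ z - u₂ z) / φ z := ⟨_, rfl⟩
  have hkm : ∀ x, ‖x‖ ≤ ρ → u₁ x - u₂ x ≤ k * φ x := by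
    intro x hx
    have hx' := mem_closedBall_zero_iff.2 hx
    rw [hk]
    exact (div_le_iff₀ (hφp x (hin x hx'))).1 (hzm hx')
  have hzk : u₁ z - u₂ z = k * φ z := by
    rw [hk, div_mul_cancel₀ _ (hφp z hz1).ne']
  rcases le_or_gt k 0 with hk0 | hk0
  · have h0 : ∀ x, ‖x‖ ≤ ρ → u₁ x - u₂ x ≤ 0 * φ x := by
      intro x hx
      have h1 := hkm x hx
      have h2 := mul_nonpos_of_nonpos_of_nonneg hk0 (hφp x (by linarith)).le
      linarith
    rcases le_total ‖xx‖ ρ with h | h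
    · have := h0 xx h
      linarith
    · have := annulus hN hf0 hlam hmono hφreg hφpos hφeq hu₁ hu₂ hρ hl le_rfl
        (fun x hx => h0 x hx.le) h hxx
      linarith
  exfalso
  have hall : ∀ x, ‖x‖ < 1 → u₁ x - u₂ x ≤ k * φ x := by
    intro x hx
    rcases le_total ‖x‖ ρ with h | h
    · exact hkm x h
    · exact annulus hN hf0 hlam hmono hφreg hφpos hφeq hu₁ hu₂ hρ hl hk0.le
        (fun x hx => hkm x hx.le) h hx
  have hv := cd_v (k := k) hφreg hu₁ hu₂
  have hcont : ∀ {u : EuclideanSpace ℝ (Fin N) → ℝ} {x}, ContDiffOn ℝ 2 u (ball 0 1) → ‖x‖ < 1 →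
      ContinuousAt u x := fun h hx => (contDiffAt_of_ball h hx).continuousAt
  have hzero := strongMP hN hv (x0 := z)
    (fun x hx => by have := hall x hx; linarith)
    (by
      intro x hx hvx
      have hw : 0 < u₁ x - u₂ x := by
        have := mul_pos hk0 (hφp x hx)
        linarith
      have hc : ContinuousAt (fun y => u₁ y - u₂ y) x := (hcont hu₁.1 hx).sub (hcont hu₂.1 hx)
      filter_upwards [hc.eventually (lt_mem_nhds hw),
        isOpen_ball.mem_nhds (mem_ball_zero_iff.2 hx)] with y hy hy1
      rw [mem_ball_zero_iff] at hy1
      rw [lap_v hφreg hφeq hu₁ hu₂ hy1]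
      have h1 := hmono (show u₂ y ≤ u₁ y by linarith)
      have h2 := mul_le_mul_of_nonneg_left (hall y hy1) hlam.le
      simp only at h1
      linarith)
    hz1 (by linarith)
  have hw : ∀ x, ‖x‖ < 1 → u₁ x - u₂ x = k * φ x := fun x hx => by
    have := hzero x hx
    linarith
  refine const_contra hN hfc hf0 hlam hmono (u₁ := u₁) hu₂ (fun x hx => ?_) (fun x hx => ?_)
  · have := mul_pos hk0 (hφp x hx)
    have := hw x hx
    linarith
  · have hev : (fun y => (u₁ y - 1 * u₂ y) - k * φ y) =ᶠ[𝓝 x] fun _ => 0 := by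
      filter_upwards [isOpen_ball.mem_nhds (mem_ball_zero_iff.2 hx)] with y hy
      exact hzero y (mem_ball_zero_iff.1 hy)
    have hl0 : lap (fun y => (u₁ y - 1 * u₂ y) - k * φ y) x = 0 := by
      unfold lap
      refine Finset.sum_eq_zero fun i _ => ?_
      have h2 : (fun y => fderiv ℝ (fun y => (u₁ y - 1 * u₂ y) - k * φ y) y
          (EuclideanSpace.single i 1)) =ᶠ[𝓝 x] fun _ => 0 := by
        filter_upwards [hev.fderiv (𝕜 := ℝ)] with y hy
        rw [hy]; simp
      rw [h2.fderiv_eq]; simp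
    rw [lap_v hφreg hφeq hu₁ hu₂ hx] at hl0
    have h3 := hw x hx
    have h4 : lam * (u₁ x - u₂ x) = lam * (k * φ x) := by rw [h3]
    linarith
end

theorem statement3 {N : ℕ} (hN : 1 ≤ N) (f : ℝ → ℝ) (hf : ContDiff ℝ 1 f)
    -- condition (2)
    (a : ℝ) (ha : 0 < f a) (hf0 : ∀ t > a, 0 ≤ f t)
    (F : ℝ → ℝ) (hF : ∀ t, F t = ∫ s in a..t, f s)
    -- condition (3): Keller-Osserman
    (hKO : ∃ T, (∀ t ≥ T, 0 < F t) ∧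
      IntegrableOn (fun t => (Real.sqrt (F t))⁻¹) (Ici T))
    -- λ₁ is the principal Dirichlet eigenvalue of -Δ on B: it is positive and
    -- admits a positive eigenfunction φ vanishing on ∂B
    (lam : ℝ) (hlam : 0 < lam)
    (φ : EuclideanSpace ℝ (Fin N) → ℝ)
    (hφreg : ContDiffOn ℝ 2 φ (ball 0 1))
    (hφcont : ContinuousOn φ (closedBall 0 1))
    (hφpos : ∀ x ∈ ball (0 : EuclideanSpace ℝ (Fin N)) 1, 0 < φ x)
    (hφeq : ∀ x ∈ ball (0 : EuclideanSpace ℝ (Fin N)) 1, lap φ x = -lam * φ x)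
    (hφ0 : ∀ x : EuclideanSpace ℝ (Fin N), ‖x‖ = 1 → φ x = 0)
    -- t ↦ f(t) + λ₁ t is nondecreasing
    (hmono : Monotone fun t => f t + lam * t)
    (u₁ u₂ : EuclideanSpace ℝ (Fin N) → ℝ)
    (hu₁ : IsBlowUp f u₁) (hu₂ : IsBlowUp f u₂) :
    ∀ x ∈ ball (0 : EuclideanSpace ℝ (Fin N)) 1, u₁ x = u₂ x := by
  intro x hx
  rw [mem_ball_zero_iff] at hx
  exact le_antisymm
    (main_le hN hf.continuous hf0 hlam hmono hφreg hφpos hφeq hu₁ hu₂ hx)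
    (main_le hN hf.continuous hf0 hlam hmono hφreg hφpos hφeq hu₂ hu₁ hx)
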